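/- arXiv:2301.06728 — 4 statements merged into one kernel-verified Lean document; each statement's English description precedes it below -/
import Mathlib

section
/- Let (P_n)_{n≥0} be a monic OPS with recurrence coefficients (B_n, C_n) satisfying 𝒟_q(𝒮_q P_n) = r_n P_{n−1} for all n ≥ 0, for some constants r_n ∈ ℂ. Set t_n = r_n/C_n for n ≥ 1. Then: (i) for all n ≥ 1, r_{n+1}B_{n+1} − (4α² − 3)(r_n + r_{n+1})B_n + r_n B_{n−1} = 0; (ii) for all n ≥ 1, t_{n+3}B_{n+2} − (t_{n+2} + t_{n+1})B_{n+1} + t_n B_n = 0; (iii) for all n ≥ 3, t_{n+2}(C_{n+1} − 1/4) − 2t_n(C_n − 1/4) + t_{n−2}(C_{n−1} − 1/4) = t_n [B_n² − 2(2α² − 1)B_n B_{n−1} + B_{n−1}²]. -/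
open Polynomial

noncomputable section

/-- `q^{1/2}` as a complex number, for a real `q`. -/
def qh (q : ℝ) : ℂ := ((Real.sqrt q : ℝ) : ℂ)

/-- `α = (q^{1/2} + q^{-1/2})/2`. -/
def alp (q : ℝ) : ℂ := (qh q + (qh q)⁻¹) / 2

/-- `α_n = (q^{n/2} + q^{-n/2})/2` (so that `α_{-1} = α`). -/
def alpn (q : ℝ) (n : ℤ) : ℂ := ((qh q) ^ n + (qh q) ^ (-n)) / 2

/-- `γ_n = (q^{n/2} - q^{-n/2})/(q^{1/2} - q^{-1/2})` (so that `γ_{-1} = -1`). -/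
def gamn (q : ℝ) (n : ℤ) : ℂ := ((qh q) ^ n - (qh q) ^ (-n)) / (qh q - (qh q)⁻¹)

/-- `U₂(z) = (α² - 1)(z² - 1)` as a polynomial. -/
def U2 (q : ℝ) : ℂ[X] := Polynomial.C ((alp q) ^ 2 - 1) * (X ^ 2 - 1)

/-- Defining property of the Askey–Wilson operator `𝒟_q` on `ℂ[z]`:
for every `w ≠ 0` with `w² ≠ 1`,
`(𝒟_q p)((w+w⁻¹)/2) = [p((q^{1/2}w+q^{-1/2}w⁻¹)/2) − p((q^{-1/2}w+q^{1/2}w⁻¹)/2)]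
  / (((q^{1/2}−q^{-1/2})/2)(w−w⁻¹))`. -/
def IsAW (q : ℝ) (D : ℂ[X] → ℂ[X]) : Prop :=
  ∀ p : ℂ[X], ∀ w : ℂ, w ≠ 0 → w ^ 2 ≠ 1 →
    (D p).eval ((w + w⁻¹) / 2) =
      (p.eval ((qh q * w + (qh q)⁻¹ * w⁻¹) / 2) -
          p.eval (((qh q)⁻¹ * w + qh q * w⁻¹) / 2)) /
        (((qh q - (qh q)⁻¹) / 2) * (w - w⁻¹))

/-- Defining property of the averaging operator `𝒮_q` on `ℂ[z]`:
for every `w ≠ 0` with `w² ≠ 1`,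
`(𝒮_q p)((w+w⁻¹)/2) = (1/2)[p((q^{1/2}w+q^{-1/2}w⁻¹)/2) + p((q^{-1/2}w+q^{1/2}w⁻¹)/2)]`. -/
def IsAv (q : ℝ) (S : ℂ[X] → ℂ[X]) : Prop :=
  ∀ p : ℂ[X], ∀ w : ℂ, w ≠ 0 → w ^ 2 ≠ 1 →
    (S p).eval ((w + w⁻¹) / 2) =
      (p.eval ((qh q * w + (qh q)⁻¹ * w⁻¹) / 2) +
          p.eval (((qh q)⁻¹ * w + qh q * w⁻¹) / 2)) / 2

/-- A monic orthogonal polynomial sequence with recurrence coefficients `(B_n, C_n)`: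
monic polynomials, `deg P_n = n`, `P_0 = 1` and the three-term recurrence
`P_{n+1} = (z - B_n) P_n - C_n P_{n-1}` (with `P_{-1} = 0`), `C_n ≠ 0` for `n ≥ 1`. -/
structure MonicOPS (P : ℕ → ℂ[X]) (B Co : ℕ → ℂ) : Prop where
  monic : ∀ n, (P n).Monic
  deg : ∀ n, (P n).natDegree = n
  p0 : P 0 = 1
  p1 : P 1 = X - Polynomial.C (B 0)
  ttrr : ∀ n : ℕ,
    P (n + 2) = (X - Polynomial.C (B (n + 1))) * P (n + 1) - Polynomial.C (Co (n + 1)) * P n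
  Cne : ∀ n : ℕ, 1 ≤ n → Co n ≠ 0

/-- The Appell-type property `𝒮_q(𝒟_q P_n) = k_n P_{n-1}` for all `n ≥ 0` (with `P_{-1} = 0`). -/
def AppellSD (Sq Dq : ℂ[X] → ℂ[X]) (P : ℕ → ℂ[X]) (k : ℕ → ℂ) : Prop :=
  Sq (Dq (P 0)) = 0 ∧ ∀ n : ℕ, Sq (Dq (P (n + 1))) = Polynomial.C (k (n + 1)) * P n

/-- The Appell-type property `𝒟_q(𝒮_q P_n) = k_n P_{n-1}` for all `n ≥ 0` (with `P_{-1} = 0`). -/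
def AppellDS (Dq Sq : ℂ[X] → ℂ[X]) (P : ℕ → ℂ[X]) (k : ℕ → ℂ) : Prop :=
  Dq (Sq (P 0)) = 0 ∧ ∀ n : ℕ, Dq (Sq (P (n + 1))) = Polynomial.C (k (n + 1)) * P n

end

lemma indep5 {P : ℕ → ℂ[X]} {B Co : ℕ → ℂ} (h : MonicOPS P B Co) (m : ℕ)
    (c0 c1 c2 c3 c4 : ℂ)
    (hz : Polynomial.C c4 * P (m + 4) + Polynomial.C c3 * P (m + 3) + Polynomial.C c2 * P (m + 2)
      + Polynomial.C c1 * P (m + 1) + Polynomial.C c0 * P m = 0) :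
    c4 = 0 ∧ c3 = 0 ∧ c2 = 0 ∧ c1 = 0 ∧ c0 = 0 := by
  have top : ∀ k, (P k).coeff k = 1 := fun k => by
    have := h.monic k
    rw [Polynomial.Monic, Polynomial.leadingCoeff, h.deg] at this
    exact this
  have low : ∀ k l, k < l → (P k).coeff l = 0 := fun k l hl =>
    Polynomial.coeff_eq_zero_of_natDegree_lt (by rw [h.deg]; exact hl)
  have cf := fun l => congrArg (fun p : ℂ[X] => p.coeff l) hz
  simp only [Polynomial.coeff_add, Polynomial.coeff_C_mul, Polynomial.coeff_zero] at cf
  have e4 : c4 = 0 := by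
    have := cf (m + 4)
    rw [top, low (m+3) _ (by omega), low (m+2) _ (by omega), low (m+1) _ (by omega),
      low m _ (by omega)] at this
    linear_combination this
  subst e4
  have e3 : c3 = 0 := by
    have := cf (m + 3)
    rw [top, low (m+2) _ (by omega), low (m+1) _ (by omega),
      low m _ (by omega)] at this
    linear_combination this
  subst e3
  have e2 : c2 = 0 := by
    have := cf (m + 2)
    rw [top, low (m+1) _ (by omega), low m _ (by omega)] at this
    linear_combination this
  subst e2
  have e1 : c1 = 0 := by
    have := cf (m + 1)
    rw [top, low m _ (by omega)] at this
    linear_combination this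
  subst e1
  have e0 : c0 = 0 := by
    have := cf m
    rw [top] at this
    linear_combination this
  exact ⟨rfl, rfl, rfl, rfl, e0⟩

lemma zero_of_eval (M : ℝ) (hM : 1 ≤ M) (F : ℂ[X])
    (hF : ∀ v : ℝ, M < v → F.eval (((v : ℂ) + (v : ℂ)⁻¹) / 2) = 0) : F = 0 := by
  apply Polynomial.eq_zero_of_infinite_isRoot
  have hinj : Set.InjOn (fun v : ℝ => ((v : ℂ) + (v : ℂ)⁻¹) / 2) (Set.Ioi M) := by
    intro u hu v hv huv
    have hu' : M < u := hu
    have hv' : M < v := hv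
    have h1 : (u + u⁻¹) / 2 = (v + v⁻¹) / 2 := by
      have : ((u : ℂ) + (u : ℂ)⁻¹) / 2 = ((v : ℂ) + (v : ℂ)⁻¹) / 2 := huv
      exact_mod_cast this
    have hu0 : u ≠ 0 := by linarith
    have hv0 : v ≠ 0 := by linarith
    field_simp at h1
    have h2 : (u - v) * (u * v - 1) = 0 := by linear_combination h1
    rcases mul_eq_zero.1 h2 with h3 | h3
    · linarith
    · nlinarith
  refine ((Set.Ioi_infinite M).image hinj).mono ?_
  rintro _ ⟨v, hv, rfl⟩
  exact hF v hv

/-- The pointwise data: values of `α 𝒜 P_n` at a point, with the two recurrences. -/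
lemma pointwise (q : ℝ) (hq0 : 0 < q) (hq1 : q < 1)
    (Dq Sq : ℂ[X] → ℂ[X]) (hD : IsAW q Dq) (hS : IsAv q Sq)
    (P : ℕ → ℂ[X]) (B Co : ℕ → ℂ) (hops : MonicOPS P B Co)
    (r : ℕ → ℂ) (hAp : AppellDS Dq Sq P r) (v : ℝ) (hv : 1 / q < v) (a x : ℂ)
    (ha : a = 2 * alp q ^ 2 - 1) (hx : x = ((v : ℂ) + (v : ℂ)⁻¹) / 2) :
    ∃ G : ℕ → ℂ, G 0 = r 1 * (P 0).eval x ∧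
      G 1 = r 2 * (P 1).eval x - (a * x - B 1) * r 1 * (P 0).eval x ∧
      (∀ n, G (n + 2) = r (n + 3) * (P (n + 2)).eval x
        - (a * x - B (n + 2)) * r (n + 2) * (P (n + 1)).eval x
        + Co (n + 2) * r (n + 1) * (P n).eval x) ∧
      (∀ n, G (n + 2) = (a * x - B (n + 1)) * G (n + 1)
        + (a ^ 2 - 1) * (x ^ 2 - 1) * r (n + 1) * (P n).eval x - Co (n + 1) * G n) := by
  obtain ⟨s, hs, hs0, hs1, hsq⟩ : ∃ s : ℝ, qh q = (s : ℂ) ∧ 0 < s ∧ s < 1 ∧ s ^ 2 = q :=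
    ⟨Real.sqrt q, rfl, Real.sqrt_pos.2 hq0, by
      rw [Real.sqrt_lt' one_pos]; simpa using hq1, Real.sq_sqrt hq0.le⟩
  have hsv : 1 < s * v * s := by
    rw [div_lt_iff₀ hq0] at hv
    rw [← hsq] at hv
    nlinarith
  have hv0 : 0 < v := lt_trans (by positivity) hv
  have hsv1 : 1 < s * v := by nlinarith [mul_pos hs0 hv0]
  have hv1 : 1 < v := by nlinarith
  have hvs : 1 < s⁻¹ * v := by
    have : 1 < s⁻¹ := (one_lt_inv₀ hs0).2 hs1
    nlinarith
  have sqne : ∀ u : ℝ, 1 < u → (u : ℂ) ^ 2 ≠ 1 := by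
    intro u hu h
    have : u ^ 2 = 1 := by exact_mod_cast h
    nlinarith
  have zne : ∀ u : ℝ, 1 < u → (u : ℂ) ≠ 0 := by
    intro u hu h
    have : u = 0 := by exact_mod_cast h
    linarith
  have hsC : (s : ℂ) ≠ 0 := by exact_mod_cast hs0.ne'
  have hvC : (v : ℂ) ≠ 0 := zne v hv1
  have hw2 := sqne v hv1
  have halp : alp q = ((s : ℂ) + (s : ℂ)⁻¹) / 2 := by rw [alp, hs]
  generalize hd : ((v : ℂ) - (v : ℂ)⁻¹) = d
  generalize hk : ((s : ℂ) - (s : ℂ)⁻¹) = k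
  have hd0 : d ≠ 0 := by
    rw [← hd]; intro h
    apply hw2
    field_simp at h
    linear_combination h
  have hk0 : k ≠ 0 := by
    rw [← hk]; intro h
    have : (s : ℂ) ^ 2 = 1 := by
      field_simp at h
      linear_combination h
    have : s ^ 2 = 1 := by exact_mod_cast this
    nlinarith
  generalize hal : alp q = al at *
  have hy : ((s : ℂ) * (s * v) + (s : ℂ)⁻¹ * ((s : ℂ) * v)⁻¹) / 2 = a * x + k * al * d / 2 := by
    rw [ha, hx, halp, ← hk, ← hd]; field_simp; ring
  have hz : ((s : ℂ)⁻¹ * ((s : ℂ)⁻¹ * v) + (s : ℂ) * ((s : ℂ)⁻¹ * v)⁻¹) / 2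
      = a * x - k * al * d / 2 := by
    rw [ha, hx, halp, ← hk, ← hd]; field_simp; ring
  have hb2 : (k * al) ^ 2 = a ^ 2 - 1 := by
    rw [ha, halp, ← hk]; field_simp; ring
  have hd2 : d ^ 2 / 4 = x ^ 2 - 1 := by
    rw [hx, ← hd]; field_simp; ring
  -- difference formula
  have hDS : ∀ p : ℂ[X], p.eval (a * x + k * al * d / 2) - p.eval (a * x - k * al * d / 2)
      = k * d * (Dq (Sq p)).eval x := by
    intro p
    have e1 := hD (Sq p) v hvC hw2
    have e2 := hS p ((s * v : ℝ) : ℂ) (zne _ hsv1) (sqne _ hsv1)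
    have e3 := hS p ((s⁻¹ * v : ℝ) : ℂ) (zne _ hvs) (sqne _ hvs)
    push_cast at e2 e3
    rw [hs] at e1 e2 e3
    rw [hy] at e2
    rw [hz] at e3
    have c1 : ((s : ℂ) * v + (s : ℂ)⁻¹ * (v : ℂ)⁻¹) / 2 = (s * v + ((s : ℂ) * v)⁻¹) / 2 := by
      rw [mul_inv]
    have c2 : ((s : ℂ)⁻¹ * v + (s : ℂ) * (v : ℂ)⁻¹) / 2
        = ((s : ℂ)⁻¹ * v + ((s : ℂ)⁻¹ * v)⁻¹) / 2 := by
      rw [mul_inv, inv_inv]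
    have c3 : ((s : ℂ)⁻¹ * (s * v) + (s : ℂ) * ((s : ℂ) * v)⁻¹) / 2 = x := by
      rw [hx]; field_simp
    have c4 : ((s : ℂ) * ((s : ℂ)⁻¹ * v) + (s : ℂ)⁻¹ * ((s : ℂ)⁻¹ * v)⁻¹) / 2 = x := by
      rw [hx]; field_simp
    rw [c3] at e2
    rw [c4] at e3
    rw [← hx, c1, c2, e2, e3, hk, hd] at e1
    rw [e1]
    field_simp
    ring
  have hkd : k * d ≠ 0 := mul_ne_zero hk0 hd0
  obtain ⟨y, hyd⟩ : ∃ y, y = a * x + k * al * d / 2 := ⟨_, rfl⟩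
  obtain ⟨z, hzd⟩ : ∃ z, z = a * x - k * al * d / 2 := ⟨_, rfl⟩
  rw [← hyd, ← hzd] at hDS
  have hdiff : ∀ n, (P (n + 1)).eval y - (P (n + 1)).eval z
      = k * d * (r (n + 1) * (P n).eval x) := by
    intro n
    rw [hDS, hAp.2 n]
    simp
  have ttr : ∀ (n : ℕ) (u : ℂ), (P (n + 2)).eval u
      = (u - B (n + 1)) * (P (n + 1)).eval u - Co (n + 1) * eval u (P n) := by
    intro n u
    rw [hops.ttrr n]
    simp
  have p0 : ∀ u, (P 0).eval u = 1 := by intro u; rw [hops.p0]; simp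
  have p1 : ∀ u, (P 1).eval u = u - B 0 := by intro u; rw [hops.p1]; simp
  refine ⟨fun n => al * ((P n).eval y + (P n).eval z) / 2, ?_, ?_, ?_, ?_⟩
  · apply mul_left_cancel₀ hkd
    have := hdiff 0
    simp only [zero_add, p1, p0] at this ⊢
    rw [← this, hyd, hzd]; ring
  · apply mul_left_cancel₀ hkd
    have e2 := hdiff 1
    have e1 := hdiff 0
    have r1 := ttr 0 y
    have r2 := ttr 0 z
    have q1 := p0 y
    have q2 := p0 z
    simp only [zero_add, Nat.reduceAdd] at e1 e2 r1 r2 ⊢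
    rw [q1] at r1
    rw [q2] at r2
    linear_combination e2 - r1 + r2 - (a * x - B 1) * e1
      - (P 1).eval y * hyd + (P 1).eval z * hzd
  · intro n
    apply mul_left_cancel₀ hkd
    have e3 := hdiff (n + 2)
    have e2 := hdiff (n + 1)
    have e1 := hdiff n
    have r1 := ttr (n + 1) y
    have r2 := ttr (n + 1) z
    simp only [add_assoc, Nat.reduceAdd] at e1 e2 e3 r1 r2 ⊢
    linear_combination e3 - r1 + r2 - (a * x - B (n + 2)) * e2 + Co (n + 2) * e1
      - (P (n + 2)).eval y * hyd + (P (n + 2)).eval z * hzd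
  · intro n
    have e1 := hdiff n
    have r1 := ttr n y
    have r2 := ttr n z
    simp only
    rw [← hd2, ← hb2]
    linear_combination al / 2 * (r1 + r2 + (P (n + 1)).eval y * hyd + (P (n + 1)).eval z * hzd)
      + k * al ^ 2 * d / 4 * e1

/-- The five coefficient identities for `n = m + 3`. -/
lemma coeffs (q : ℝ) (hq0 : 0 < q) (hq1 : q < 1)
    (Dq Sq : ℂ[X] → ℂ[X]) (hD : IsAW q Dq) (hS : IsAv q Sq)
    (P : ℕ → ℂ[X]) (B Co : ℕ → ℂ) (hops : MonicOPS P B Co)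
    (r : ℕ → ℂ) (hAp : AppellDS Dq Sq P r) (a : ℂ) (ha : a = 2 * alp q ^ 2 - 1) :
    (r 2 * (B 2 - a * B 1) + B 1 * (r 2 - a * r 1)
        - a * ((r 2 - a * r 1) * B 1 + r 1 * (B 1 - a * B 0))
        - (a ^ 2 - 1) * r 1 * (B 1 + B 0) = 0) ∧
    (r 3 * (B 3 - a * B 2) + B 2 * (r 3 - a * r 2)
        - a * ((r 3 - a * r 2) * B 2 + r 2 * (B 2 - a * B 1))
        - (a ^ 2 - 1) * r 2 * (B 2 + B 1) = 0) ∧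
    ∀ m : ℕ,
      (r (m+4) * (B (m+4) - a * B (m+3)) + B (m+3) * (r (m+4) - a * r (m+3))
        - a * ((r (m+4) - a * r (m+3)) * B (m+3) + r (m+3) * (B (m+3) - a * B (m+2)))
        - (a ^ 2 - 1) * r (m+3) * (B (m+3) + B (m+2)) = 0) ∧
      ((Co (m+4) * r (m+3) - a * r (m+4) * Co (m+3))
        + B (m+3) * (r (m+3) * (B (m+3) - a * B (m+2))) + Co (m+3) * (r (m+3) - a * r (m+2))
        - a * ((r (m+4) - a * r (m+3)) * Co (m+3) + r (m+3) * (B (m+3) - a * B (m+2)) * B (m+2)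
          + (Co (m+3) * r (m+2) - a * r (m+3) * Co (m+2)))
        - (a ^ 2 - 1) * r (m+3) * (B (m+2) ^ 2 + Co (m+3) + Co (m+2) - 1) = 0) ∧
      (B (m+3) * (Co (m+3) * r (m+2) - a * r (m+3) * Co (m+2))
        + Co (m+3) * (r (m+2) * (B (m+2) - a * B (m+1)))
        - a * ((Co (m+3) * r (m+2) - a * r (m+3) * Co (m+2)) * B (m+1)
          + r (m+3) * (B (m+3) - a * B (m+2)) * Co (m+2))
        - (a ^ 2 - 1) * r (m+3) * Co (m+2) * (B (m+2) + B (m+1)) = 0) ∧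
      (Co (m+3) * (Co (m+2) * r (m+1) - a * r (m+2) * Co (m+1))
        - a * (Co (m+3) * r (m+2) - a * r (m+3) * Co (m+2)) * Co (m+1)
        - (a ^ 2 - 1) * r (m+3) * Co (m+2) * Co (m+1) = 0) := by
  have hM : 1 ≤ 1 / q := by rw [le_div_iff₀ hq0]; linarith
  have ttr : ∀ (n : ℕ) (u : ℂ), (P (n + 2)).eval u
      = (u - B (n + 1)) * (P (n + 1)).eval u - Co (n + 1) * eval u (P n) := by
    intro n u
    rw [hops.ttrr n]
    simp
  have p0 : ∀ u, (P 0).eval u = 1 := by intro u; rw [hops.p0]; simp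
  have p1 : ∀ u, (P 1).eval u = u - B 0 := by intro u; rw [hops.p1]; simp
  refine ⟨?_, ?_, ?_⟩
  · refine (indep5 hops 0
      (Co 2 * r 1 - a * r 2 * Co 1 + B 1 * r 1 * (B 1 - a * B 0) + Co 1 * r 1
        - a * ((r 2 - a * r 1) * Co 1 + r 1 * (B 1 - a * B 0) * B 0)
        - (a ^ 2 - 1) * r 1 * (B 0 ^ 2 + Co 1 - 1)) _
      (r 3 - a * r 2 - a * (r 2 - a * r 1) - (a ^ 2 - 1) * r 1) 0 0 ?_).2.2.2.1
    apply zero_of_eval _ hM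
    intro v hv
    obtain ⟨G, g0, g1, g2, g3⟩ := pointwise q hq0 hq1 Dq Sq hD hS P B Co hops r hAp v hv a _ ha rfl
    generalize ((v : ℂ) + (v : ℂ)⁻¹) / 2 = x at *
    have E := g3 0
    rw [g2 0] at E
    simp only [zero_add, Nat.reduceAdd] at E ⊢
    rw [g1, g0] at E
    have R := ttr 0 x
    simp only [zero_add, Nat.reduceAdd] at R
    simp only [eval_add, eval_mul, eval_C, R, p1, p0] at E ⊢
    linear_combination E
  · refine (indep5 hops 0
      (B 2 * (Co 2 * r 1 - a * r 2 * Co 1) + Co 2 * (r 1 * (B 1 - a * B 0))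
        - a * ((Co 2 * r 1 - a * r 2 * Co 1) * B 0 + r 2 * (B 2 - a * B 1) * Co 1)
        - (a ^ 2 - 1) * r 2 * Co 1 * (B 1 + B 0))
      ((Co 3 * r 2 - a * r 3 * Co 2)
        + B 2 * (r 2 * (B 2 - a * B 1)) + Co 2 * (r 2 - a * r 1)
        - a * ((r 3 - a * r 2) * Co 2 + r 2 * (B 2 - a * B 1) * B 1
          + (Co 2 * r 1 - a * r 2 * Co 1))
        - (a ^ 2 - 1) * r 2 * (B 1 ^ 2 + Co 2 + Co 1 - 1)) _
      (r 4 - a * r 3 - a * (r 3 - a * r 2) - (a ^ 2 - 1) * r 2) 0 ?_).2.2.1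
    apply zero_of_eval _ hM
    intro v hv
    obtain ⟨G, g0, g1, g2, g3⟩ := pointwise q hq0 hq1 Dq Sq hD hS P B Co hops r hAp v hv a _ ha rfl
    generalize ((v : ℂ) + (v : ℂ)⁻¹) / 2 = x at *
    have E := g3 1
    have E2 := g2 0
    have E3 := g2 1
    simp only [zero_add, Nat.reduceAdd] at E E2 E3 ⊢
    rw [E3, E2, g1] at E
    have R := ttr 0 x
    have R1 := ttr 1 x
    simp only [zero_add, Nat.reduceAdd] at R R1
    simp only [eval_add, eval_mul, eval_C, R1, R, p1, p0] at E ⊢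
    linear_combination E
  · intro m
    refine (indep5 hops m _ _ _ _
      (r (m+5) - a * r (m+4) - a * (r (m+4) - a * r (m+3)) - (a ^ 2 - 1) * r (m+3)) ?_).2
    apply zero_of_eval _ hM
    intro v hv
    obtain ⟨G, g0, g1, g2, g3⟩ := pointwise q hq0 hq1 Dq Sq hD hS P B Co hops r hAp v hv a _ ha rfl
    generalize ((v : ℂ) + (v : ℂ)⁻¹) / 2 = x at *
    have E := g3 (m + 2)
    have E2 := g2 m
    have E3 := g2 (m + 1)
    have E4 := g2 (m + 2)
    have R := ttr m x
    have R1 := ttr (m + 1) x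
    have R2 := ttr (m + 2) x
    simp only [add_assoc, Nat.reduceAdd] at E E2 E3 E4 R R1 R2 ⊢
    rw [E4, E3, E2] at E
    simp only [eval_add, eval_mul, eval_C, R2, R1, R] at E ⊢
    linear_combination E


/-- for a monic OPS with `𝒟_q(𝒮_q P_n) = r_n P_{n-1}`, setting
`t_n = r_n/C_n`, the stated three difference equations for `B_n` and `C_n` hold. -/
theorem stmt_16 (q : ℝ) (hq0 : 0 < q) (hq1 : q < 1)
    (Dq Sq : ℂ[X] → ℂ[X]) (hD : IsAW q Dq) (hS : IsAv q Sq)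
    (P : ℕ → ℂ[X]) (B Co : ℕ → ℂ) (hops : MonicOPS P B Co)
    (r : ℕ → ℂ) (hAp : AppellDS Dq Sq P r)
    (t : ℕ → ℂ) (ht : ∀ n : ℕ, 1 ≤ n → t n = r n / Co n) :
    (∀ n : ℕ, 1 ≤ n →
      r (n + 1) * B (n + 1) - (4 * (alp q) ^ 2 - 3) * (r n + r (n + 1)) * B n +
        r n * B (n - 1) = 0) ∧
    (∀ n : ℕ, 1 ≤ n →
      t (n + 3) * B (n + 2) - (t (n + 2) + t (n + 1)) * B (n + 1) + t n * B n = 0) ∧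
    (∀ n : ℕ, 3 ≤ n →
      t (n + 2) * (Co (n + 1) - 1 / 4) - 2 * t n * (Co n - 1 / 4) +
        t (n - 2) * (Co (n - 1) - 1 / 4) =
      t n * (B n ^ 2 - 2 * (2 * (alp q) ^ 2 - 1) * B n * B (n - 1) + B (n - 1) ^ 2)) := by
  obtain ⟨h1, h2, h3⟩ := coeffs q hq0 hq1 Dq Sq hD hS P B Co hops r hAp _ rfl
  generalize alp q = al at *
  have hC := hops.Cne
  have hr : ∀ n, 1 ≤ n → r n = t n * Co n := by
    intro n hn
    rw [ht n hn, div_mul_cancel₀ _ (hC n hn)]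
  have T : ∀ m, t (m + 1) - 2 * (2 * al ^ 2 - 1) * t (m + 2) + t (m + 3) = 0 := by
    intro m
    obtain ⟨-, -, -, h⟩ := h3 m
    rw [hr (m + 1) (by omega), hr (m + 2) (by omega), hr (m + 3) (by omega)] at h
    have hne : Co (m + 3) * Co (m + 2) * Co (m + 1) ≠ 0 :=
      mul_ne_zero (mul_ne_zero (hC _ (by omega)) (hC _ (by omega))) (hC _ (by omega))
    apply mul_left_cancel₀ hne
    linear_combination h
  refine ⟨?_, ?_, ?_⟩
  · intro n hn
    match n, hn with
    | 1, _ => simp only [Nat.reduceAdd, Nat.reduceSub]; linear_combination h1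
    | 2, _ => simp only [Nat.reduceAdd, Nat.reduceSub]; linear_combination h2
    | m + 3, _ =>
      obtain ⟨h, -⟩ := h3 m
      have e : m + 3 - 1 = m + 2 := by omega
      rw [e]
      simp only [add_assoc, Nat.reduceAdd]
      linear_combination h
  · intro n hn
    obtain ⟨m, rfl⟩ : ∃ m, n = m + 1 := ⟨n - 1, by omega⟩
    obtain ⟨-, -, h, -⟩ := h3 m
    have T0 := T m
    have T1 := T (m + 1)
    simp only [add_assoc, Nat.reduceAdd] at T1 ⊢
    rw [hr (m + 2) (by omega), hr (m + 3) (by omega)] at h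
    have hne : Co (m + 3) * Co (m + 2) ≠ 0 := mul_ne_zero (hC _ (by omega)) (hC _ (by omega))
    apply mul_left_cancel₀ hne
    linear_combination -h + Co (m + 3) * Co (m + 2) * (B (m + 3) * T1 + B (m + 1) * T0)
  · intro n hn
    obtain ⟨m, rfl⟩ : ∃ m, n = m + 3 := ⟨n - 3, by omega⟩
    obtain ⟨-, h, -, -⟩ := h3 m
    have T0 := T m
    have T1 := T (m + 1)
    have T2 := T (m + 2)
    have e1 : m + 3 - 1 = m + 2 := by omega
    have e2 : m + 3 - 2 = m + 1 := by omega
    rw [e1, e2]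
    simp only [add_assoc, Nat.reduceAdd] at T1 T2 ⊢
    rw [hr (m + 2) (by omega), hr (m + 3) (by omega), hr (m + 4) (by omega)] at h
    apply mul_left_cancel₀ (hC (m + 3) (by omega))
    linear_combination -h + Co (m + 3) * (Co (m + 4) * T2 + Co (m + 2) * T0
      - 1 / 4 * (T2 + T0 + 2 * (2 * al ^ 2 - 1) * T1))
end

section
/- A monic OPS (P_n)_{n≥0} with recurrence coefficients (B_n, C_n) satisfies 𝒟_q(𝒮_q P_n) = k_n P_{n−1} for all n ≥ 0, for some constants k_n ∈ ℂ, if and only if B_n = 0 for all n ≥ 0 and there exists s ∈ {1, −1} such that C_n = (1/4)(1 − q^{2sn}) for all n ≥ 1. In this case k_n = γ_{2n}/2 for all n ≥ 1 (and k_0 = 0); that is, (P_n) is the monic Rogers q^{2}-Hermite or Rogers q^{−2}-Hermite polynomial sequence, i.e. the Al-Salam–Chihara sequence Q_n(z; s q^{s/2}, −s q^{s/2} | q^s). -/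
open Polynomial

section Helpers

lemma aux_good_x (q : ℝ) (hq0 : 0 < q) (x : ℂ) :
    ∃ w : ℂ, w ≠ 0 ∧ (w + w⁻¹) / 2 = x ∧
      (x ^ 2 ≠ 1 → 4 * x ^ 2 ≠ (q : ℂ) + 2 + (q : ℂ)⁻¹ →
        w ^ 2 ≠ 1 ∧ w ^ 2 ≠ q ∧ w ^ 2 ≠ (q : ℂ)⁻¹) := by
  obtain ⟨s, hs⟩ : ∃ s : ℂ, s ^ 2 = x ^ 2 - 1 :=
    ⟨_, Complex.cpow_nat_inv_pow (x ^ 2 - 1) two_ne_zero⟩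
  have hw : x + s ≠ 0 := by
    intro h
    have : (x + s) * (x - s) = 1 := by linear_combination -hs
    rw [h] at this; simp at this
  have hinv : (x + s)⁻¹ = x - s := by
    rw [inv_eq_iff_eq_inv, eq_comm, inv_eq_iff_eq_inv]
    refine eq_inv_of_mul_eq_one_left ?_
    linear_combination -hs
  have hqc : (q : ℂ) ≠ 0 := by exact_mod_cast hq0.ne'
  refine ⟨x + s, hw, by rw [hinv]; ring, fun h1 h2 => ?_⟩
  generalize hwd : x + s = w at *
  have hx : x = (w + w⁻¹) / 2 := by rw [hinv, ← hwd]; ring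
  have h4 : 4 * x ^ 2 = w ^ 2 + 2 + (w ^ 2)⁻¹ := by
    rw [hx]; field_simp; ring
  refine ⟨?_, ?_, ?_⟩
  · intro h
    rw [h] at h4
    apply h1
    rw [inv_one] at h4
    linear_combination h4 / 4
  · intro h
    rw [h] at h4
    exact h2 h4
  · intro h
    rw [h, inv_inv] at h4
    apply h2
    rw [h4]; ring

lemma aux_poly_ext (d : ℂ) (F : ℂ[X])
    (h : ∀ x : ℂ, x ^ 2 ≠ 1 → 4 * x ^ 2 ≠ d → F.eval x = 0) : F = 0 := by
  have hz : F * ((X ^ 2 - 1) * (4 * X ^ 2 - C d)) = 0 := by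
    apply Polynomial.funext
    intro x
    by_cases h1 : x ^ 2 = 1
    · simp [h1]
    by_cases h2 : 4 * x ^ 2 = d
    · simp [h2]
    · simp [h x h1 h2]
  rcases mul_eq_zero.1 hz with h0 | h0
  · exact h0
  exfalso
  rcases mul_eq_zero.1 h0 with h0 | h0
  · have := congrArg (fun p => Polynomial.eval 0 p) h0
    simp at this
  · have h1 := congrArg (fun p => Polynomial.eval 0 p) h0
    have h2 := congrArg (fun p => Polynomial.eval 1 p) h0
    simp at h1 h2
    rw [h1] at h2
    norm_num at h2

lemma aux_qh (q : ℝ) (hq0 : 0 < q) : qh q ^ 2 = q := by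
  unfold qh
  exact_mod_cast Real.sq_sqrt hq0.le

lemma aux_qh_ne (q : ℝ) (hq0 : 0 < q) : qh q ≠ 0 := by
  intro h
  have := aux_qh q hq0
  rw [h] at this
  have hqc : (q : ℂ) ≠ 0 := by exact_mod_cast hq0.ne'
  apply hqc; rw [← this]; simp

lemma aux_qh_sub (q : ℝ) (hq0 : 0 < q) (hq1 : q < 1) : qh q - (qh q)⁻¹ ≠ 0 := by
  have h0 := aux_qh_ne q hq0
  intro h
  have h1 : qh q ^ 2 = 1 := by
    field_simp at h
    linear_combination h
  rw [aux_qh q hq0] at h1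
  have : q = 1 := by exact_mod_cast h1
  linarith

lemma aux_bridge (q : ℝ) (hq0 : 0 < q) (hq1 : q < 1)
    (Dq Sq : ℂ[X] → ℂ[X]) (hD : IsAW q Dq) (hS : IsAv q Sq) (p : ℂ[X]) (w : ℂ)
    (hw : w ≠ 0) (h1 : w ^ 2 ≠ 1) (h2 : w ^ 2 ≠ q) (h3 : w ^ 2 ≠ (q : ℂ)⁻¹) :
    (Dq (Sq p)).eval ((w + w⁻¹) / 2) * ((qh q - (qh q)⁻¹) * (w - w⁻¹)) =
      p.eval ((q * w + (q : ℂ)⁻¹ * w⁻¹) / 2) - p.eval (((q : ℂ)⁻¹ * w + q * w⁻¹) / 2) := by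
  have h0 := aux_qh_ne q hq0
  have hs := aux_qh_sub q hq0 hq1
  have hsq := aux_qh q hq0
  have hww : w - w⁻¹ ≠ 0 := by
    intro h
    apply h1
    field_simp at h
    linear_combination h
  have e1 := hD (Sq p) w hw h1
  have e2 := hS p (qh q * w) (mul_ne_zero h0 hw) (by
    rw [mul_pow, hsq]
    intro h
    exact h3 (eq_inv_of_mul_eq_one_right h))
  have e3 := hS p ((qh q)⁻¹ * w) (mul_ne_zero (inv_ne_zero h0) hw) (by
    rw [mul_pow, inv_pow, hsq]
    intro h
    have hqc : (q : ℂ) ≠ 0 := by exact_mod_cast hq0.ne'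
    apply h2
    field_simp at h
    exact h)
  rw [mul_inv] at e2 e3
  rw [inv_inv] at e3
  rw [e2, e3] at e1
  rw [e1]
  have a1 : qh q * (qh q * w) + (qh q)⁻¹ * ((qh q)⁻¹ * w⁻¹) = q * w + (q : ℂ)⁻¹ * w⁻¹ := by
    rw [← hsq]; ring
  have a2 : (qh q)⁻¹ * (qh q * w) + qh q * ((qh q)⁻¹ * w⁻¹) = w + w⁻¹ := by
    field_simp
  have a3 : qh q * ((qh q)⁻¹ * w) + (qh q)⁻¹ * (qh q * w⁻¹) = w + w⁻¹ := by
    field_simp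
  have a4 : (qh q)⁻¹ * ((qh q)⁻¹ * w) + qh q * (qh q * w⁻¹) = (q : ℂ)⁻¹ * w + q * w⁻¹ := by
    rw [← hsq]; ring
  rw [a1, a2, a3, a4]
  generalize qh q - (qh q)⁻¹ = A at *
  generalize w - w⁻¹ = A' at *
  field_simp
  ring

/-- forward shift identity for the continuous `q`-Hermite type recurrence -/
lemma aux_herm (r : ℂ) (hr : r ≠ 0) (w : ℂ) (hw : w ≠ 0) (P : ℕ → ℂ[X]) (Co : ℕ → ℂ)
    (p0 : P 0 = 1) (p1 : P 1 = X)
    (ttrr : ∀ n : ℕ, P (n + 2) = X * P (n + 1) - C (Co (n + 1)) * P n)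
    (hC : ∀ n : ℕ, Co (n + 1) = (1 - r ^ (2 * (n + 1))) / 4) (n : ℕ) :
    (P (n + 1)).eval ((r * w + r⁻¹ * w⁻¹) / 2) =
        (r ^ (n + 1))⁻¹ * (P (n + 1)).eval ((w + w⁻¹) / 2) +
          (r ^ (n + 1) - (r ^ (n + 1))⁻¹) / 2 * w * (P n).eval ((w + w⁻¹) / 2) ∧
    Co (n + 1) * (P n).eval ((r * w + r⁻¹ * w⁻¹) / 2) =
      Co (n + 1) * (r ^ n)⁻¹ * (P n).eval ((w + w⁻¹) / 2) +
        r * ((r ^ (n + 1) - (r ^ (n + 1))⁻¹) / 2) * w *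
          ((w + w⁻¹) / 2 * (P n).eval ((w + w⁻¹) / 2) - (P (n + 1)).eval ((w + w⁻¹) / 2)) := by
  induction n with
  | zero =>
    simp only [p0, zero_add, p1, eval_one, eval_X]
    constructor
    · field_simp; ring
    · ring
  | succ n ih =>
    obtain ⟨i1, i2⟩ := ih
    have t1 := congrArg (fun p => eval ((w + w⁻¹) / 2) p) (ttrr n)
    have t2 := congrArg (fun p => eval ((r * w + r⁻¹ * w⁻¹) / 2) p) (ttrr n)
    simp only [eval_sub, eval_mul, eval_X, eval_C] at t1 t2
    have c1 := hC n
    have c2 := hC (n + 1)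
    constructor
    · rw [t2, i2, i1, t1, c1]
      have hrn : r ^ n ≠ 0 := pow_ne_zero _ hr
      generalize eval ((w + w⁻¹) / 2) (P n) = A
      generalize eval ((w + w⁻¹) / 2) (P (n + 1)) = A'
      have : r ^ (2 * (n + 1)) = (r ^ n) ^ 2 * r ^ 2 := by ring
      rw [this]
      have e1 : r ^ (n + 1) = r ^ n * r := by ring
      have e2 : r ^ (n + 1 + 1) = r ^ n * r ^ 2 := by ring
      rw [e1, e2]
      generalize r ^ n = z at *
      field_simp
      ring
    · rw [i1, t1, c1, c2]
      have hrn : r ^ n ≠ 0 := pow_ne_zero _ hr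
      generalize eval ((w + w⁻¹) / 2) (P n) = A
      generalize eval ((w + w⁻¹) / 2) (P (n + 1)) = A'
      have : r ^ (2 * (n + 1)) = (r ^ n) ^ 2 * r ^ 2 := by ring
      rw [this]
      have : r ^ (2 * (n + 1 + 1)) = (r ^ n) ^ 2 * r ^ 4 := by ring
      rw [this]
      have e1 : r ^ (n + 1) = r ^ n * r := by ring
      have e2 : r ^ (n + 1 + 1) = r ^ n * r ^ 2 := by ring
      rw [e1, e2]
      generalize r ^ n = z at *
      field_simp
      ring

/-- the master pointwise identity -/
lemma aux_master (a b x y : ℂ) (hy : y ≠ 0) (hyx : y ^ 2 = x ^ 2 - 1)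
    (p u v B K c : ℤ → ℂ)
    (hneg : ∀ n < 0, p n = 0 ∧ u n = 0 ∧ v n = 0)
    (hK : ∀ n ≤ 0, K n = 0) (hc : ∀ n ≤ 0, c n = 0)
    (hp : ∀ n : ℤ, 0 ≤ n → p (n + 1) = (x - B n) * p n - c n * p (n - 1))
    (hu : ∀ n : ℤ, 0 ≤ n → u (n + 1) = (a * x + b * y - B n) * u n - c n * u (n - 1))
    (hv : ∀ n : ℤ, 0 ≤ n → v (n + 1) = (a * x - b * y - B n) * v n - c n * v (n - 1))
    (hT : ∀ n : ℤ, u n - v n = 2 * y * K n * p (n - 1)) (n : ℤ) (hn : 0 ≤ n) :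
    (K (n + 2) - a * K (n + 1) - a * (K (n + 1) - a * K n) - b ^ 2 * K n) * p (n + 1) +
    (K (n + 1) * (B (n + 1) - a * B n) - (a - 1) * (K (n + 1) - a * K n) * B n
      - a * (K n * (B n - a * B (n - 1))) - b ^ 2 * K n * (B n + B (n - 1))) * p n +
    (c (n + 1) * K n - a * K (n + 1) * c n - a * (K (n + 1) - a * K n) * c n
      - a * (K n * (B n - a * B (n - 1))) * B (n - 1)
      - a * (c n * K (n - 1) - a * K n * c (n - 1)) + B n * (K n * (B n - a * B (n - 1)))
      - b ^ 2 * K n * (c n + B (n - 1) ^ 2 + c (n - 1) - 1)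
      + c n * (K n - a * K (n - 1))) * p (n - 1) +
    (- a * (K n * (B n - a * B (n - 1))) * c (n - 1)
      - a * (c n * K (n - 1) - a * K n * c (n - 1)) * B (n - 2)
      + B n * (c n * K (n - 1) - a * K n * c (n - 1))
      - b ^ 2 * K n * c (n - 1) * (B (n - 1) + B (n - 2))
      + c n * (K (n - 1) * (B (n - 1) - a * B (n - 2)))) * p (n - 2) +
    (- a * (c n * K (n - 1) - a * K n * c (n - 1)) * c (n - 2)
      - b ^ 2 * K n * c (n - 1) * c (n - 2)
      + c n * (c (n - 1) * K (n - 2) - a * K (n - 1) * c (n - 2))) * p (n - 3) = 0 := by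
  have F1 : ∀ n : ℤ, K n * (x * p (n - 1) - p n - B (n - 1) * p (n - 1)
      - c (n - 1) * p (n - 2)) = 0 := by
    intro n
    rcases le_or_gt n 0 with h | h
    · rw [hK n h, zero_mul]
    · have := hp (n - 1) (by omega)
      rw [show n - 1 + 1 = n by ring, show n - 1 - 1 = n - 2 by ring] at this
      rw [this]; ring
  have F2 : ∀ n : ℤ, c n * (x * p (n - 1) - p n - B (n - 1) * p (n - 1)
      - c (n - 1) * p (n - 2)) = 0 := by
    intro n
    rcases le_or_gt n 0 with h | h
    · rw [hc n h, zero_mul]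
    · have := hp (n - 1) (by omega)
      rw [show n - 1 + 1 = n by ring, show n - 1 - 1 = n - 2 by ring] at this
      rw [this]; ring
  have hat : ∀ j : ℤ, b * ((u j + v j) / 2) = (K (j + 1) - a * K j) * p j
      + K j * (B j - a * B (j - 1)) * p (j - 1)
      + (c j * K (j - 1) - a * K j * c (j - 1)) * p (j - 2) := by
    intro j
    rcases lt_or_ge j 0 with h | h
    · rw [(hneg j h).1, (hneg j h).2.1, (hneg j h).2.2, (hneg (j - 1) (by omega)).1,
        (hneg (j - 2) (by omega)).1]; ring
    · have t1 := hT (j + 1)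
      have t0 := hT j
      have t2 := hT (j - 1)
      rw [show j + 1 - 1 = j by ring] at t1
      rw [show j - 1 - 1 = j - 2 by ring] at t2
      have f := F1 j
      apply mul_left_cancel₀ (mul_ne_zero two_ne_zero hy)
      rw [hu j h, hv j h] at t1
      linear_combination t1 - (a * x - B j) * t0 + c j * t2 - 2 * y * a * f
  have hm := hat n
  have hm1 := hat (n + 1)
  have hm2 := hat (n - 1)
  rw [hu n hn, hv n hn] at hm1
  have t0 := hT n
  have f1 := F1 n
  have f2 := F2 n
  have f3 := F1 (n - 1)
  have f4 := F2 (n - 1)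
  have hpn := hp n hn
  rw [show n + 1 + 1 = n + 2 by ring, show n + 1 - 1 = n by ring,
    show n + 1 - 2 = n - 1 by ring] at hm1
  rw [show n - 1 + 1 = n by ring, show n - 1 - 1 = n - 2 by ring,
    show n - 1 - 2 = n - 3 by ring] at hm2
  rw [show n - 1 - 1 = n - 2 by ring, show n - 1 - 2 = n - 3 by ring] at f3 f4
  rw [hpn] at hm1 ⊢
  linear_combination (-1 : ℂ) * hm1 + b * b * y / 2 * t0 + (a * x - B n) * hm - c n * hm2
    + b ^ 2 * K n * p (n - 1) * hyx + a * (B n - a * B (n - 1)) * f1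
    + a * (c n * f3 - a * K n * f4) + b ^ 2 * ((x + B (n - 1)) * f1 + K n * f4)

end Helpers

section Helpers2

lemma aux_point (q : ℝ) (hq0 : 0 < q) (hq1 : q < 1)
    (Dq Sq : ℂ[X] → ℂ[X]) (hD : IsAW q Dq) (hS : IsAv q Sq) (x : ℂ) (hx1 : x ^ 2 ≠ 1)
    (hx2 : 4 * x ^ 2 ≠ (q : ℂ) + 2 + (q : ℂ)⁻¹) :
    ∃ y : ℂ, y ≠ 0 ∧ y ^ 2 = x ^ 2 - 1 ∧ ∀ p : ℂ[X],
      p.eval (((q : ℂ) + (q : ℂ)⁻¹) / 2 * x + ((q : ℂ) - (q : ℂ)⁻¹) / 2 * y) -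
      p.eval (((q : ℂ) + (q : ℂ)⁻¹) / 2 * x - ((q : ℂ) - (q : ℂ)⁻¹) / 2 * y) =
      2 * y * (qh q - (qh q)⁻¹) * (Dq (Sq p)).eval x := by
  obtain ⟨w, hw, hwx, h⟩ := aux_good_x q hq0 x
  obtain ⟨h1, h2, h3⟩ := h hx1 hx2
  have hyx : ((w - w⁻¹) / 2) ^ 2 = x ^ 2 - 1 := by
    rw [← hwx]; field_simp; ring
  refine ⟨(w - w⁻¹) / 2, ?_, hyx, fun p => ?_⟩
  · intro h0
    rw [h0] at hyx
    apply hx1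
    linear_combination -hyx
  · have := aux_bridge q hq0 hq1 Dq Sq hD hS p w hw h1 h2 h3
    rw [hwx] at this
    have e1 : ((q : ℂ) + (q : ℂ)⁻¹) / 2 * x + ((q : ℂ) - (q : ℂ)⁻¹) / 2 * ((w - w⁻¹) / 2) =
        (q * w + (q : ℂ)⁻¹ * w⁻¹) / 2 := by rw [← hwx]; ring
    have e2 : ((q : ℂ) + (q : ℂ)⁻¹) / 2 * x - ((q : ℂ) - (q : ℂ)⁻¹) / 2 * ((w - w⁻¹) / 2) =
        ((q : ℂ)⁻¹ * w + q * w⁻¹) / 2 := by rw [← hwx]; ring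
    rw [e1, e2, ← this]; ring

/-- extension of a sequence on `ℕ` by zero to `ℤ` -/
noncomputable def zext {M : Type*} [Zero M] (f : ℕ → M) (n : ℤ) : M :=
  if n < 0 then 0 else f n.toNat

lemma zext_neg {M : Type*} [Zero M] (f : ℕ → M) (n : ℤ) (h : n < 0) : zext f n = 0 := by
  simp [zext, h]

lemma zext_nat {M : Type*} [Zero M] (f : ℕ → M) (n : ℕ) : zext f (n : ℤ) = f n := by
  simp [zext]

lemma aux_indep (P : ℕ → ℂ[X]) (hm : ∀ n, (P n).Monic) (hd : ∀ n, (P n).natDegree = n)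
    (N : ℤ) (hN : 0 ≤ N) (c0 c1 c2 c3 c4 : ℂ)
    (h : C c0 * zext P N + C c1 * zext P (N - 1) + C c2 * zext P (N - 2)
      + C c3 * zext P (N - 3) + C c4 * zext P (N - 4) = 0) : c0 = 0 := by
  have hlow : ∀ m : ℤ, m < N → (zext P m).coeff N.toNat = 0 := by
    intro m hmN
    rcases lt_or_ge m 0 with h | h
    · rw [zext_neg _ _ h]; simp
    · lift m to ℕ using h
      rw [zext_nat]
      apply coeff_eq_zero_of_natDegree_lt
      rw [hd]; omega
  have htop : (zext P N).coeff N.toNat = 1 := by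
    lift N to ℕ using hN
    rw [zext_nat, Int.toNat_natCast]
    have := (hm N).coeff_natDegree
    rwa [hd] at this
  have := congrArg (fun p => p.coeff N.toNat) h
  simpa [coeff_C_mul, htop, hlow (N - 1) (by omega), hlow (N - 2) (by omega),
    hlow (N - 3) (by omega), hlow (N - 4) (by omega)] using this

lemma aux_rec (q : ℝ) (hq0 : 0 < q) (hq1 : q < 1)
    (Dq Sq : ℂ[X] → ℂ[X]) (hD : IsAW q Dq) (hS : IsAv q Sq)
    (P : ℕ → ℂ[X]) (Bn Co : ℕ → ℂ) (hops : MonicOPS P Bn Co) (k : ℕ → ℂ)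
    (hk : AppellDS Dq Sq P k) (a b : ℂ) (ha : a = ((q : ℂ) + (q : ℂ)⁻¹) / 2)
    (hb : b = ((q : ℂ) - (q : ℂ)⁻¹) / 2) (B K c : ℤ → ℂ)
    (hB : B = zext Bn) (hK : K = zext (fun n => if n = 0 then 0 else k n * (qh q - (qh q)⁻¹)))
    (hc : c = zext (fun n => if n = 0 then 0 else Co n)) :
    K 1 = b ∧ ∀ n : ℤ, 0 ≤ n →
    K (n + 2) - a * K (n + 1) - a * (K (n + 1) - a * K n) - b ^ 2 * K n = 0 ∧
    K (n + 1) * (B (n + 1) - a * B n) - (a - 1) * (K (n + 1) - a * K n) * B n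
      - a * (K n * (B n - a * B (n - 1))) - b ^ 2 * K n * (B n + B (n - 1)) = 0 ∧
    (1 ≤ n → c (n + 1) * K n - a * K (n + 1) * c n - a * (K (n + 1) - a * K n) * c n
      - a * (K n * (B n - a * B (n - 1))) * B (n - 1)
      - a * (c n * K (n - 1) - a * K n * c (n - 1)) + B n * (K n * (B n - a * B (n - 1)))
      - b ^ 2 * K n * (c n + B (n - 1) ^ 2 + c (n - 1) - 1)
      + c n * (K n - a * K (n - 1)) = 0) ∧
    (2 ≤ n → - a * (K n * (B n - a * B (n - 1))) * c (n - 1)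
      - a * (c n * K (n - 1) - a * K n * c (n - 1)) * B (n - 2)
      + B n * (c n * K (n - 1) - a * K n * c (n - 1))
      - b ^ 2 * K n * c (n - 1) * (B (n - 1) + B (n - 2))
      + c n * (K (n - 1) * (B (n - 1) - a * B (n - 2))) = 0) ∧
    (3 ≤ n → - a * (c n * K (n - 1) - a * K n * c (n - 1)) * c (n - 2)
      - b ^ 2 * K n * c (n - 1) * c (n - 2)
      + c n * (c (n - 1) * K (n - 2) - a * K (n - 1) * c (n - 2)) = 0) := by
  have hKneg : ∀ n ≤ 0, K n = 0 := by
    intro n hn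
    rcases hn.lt_or_eq with h | h
    · rw [hK, zext_neg _ _ h]
    · rw [h, hK]; simp [zext]
  have hcneg : ∀ n ≤ 0, c n = 0 := by
    intro n hn
    rcases hn.lt_or_eq with h | h
    · rw [hc, zext_neg _ _ h]
    · rw [h, hc]; simp [zext]
  have hrec : ∀ n : ℤ, 0 ≤ n → zext P (n + 1) =
      (X - C (B n)) * zext P n - C (c n) * zext P (n - 1) := by
    intro n hn
    lift n to ℕ using hn
    cases n with
    | zero =>
      rw [hcneg ((0 : ℕ) : ℤ) (by simp), hB]
      simp [zext, hops.p0, hops.p1]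
    | succ m =>
      have e1 : ((m + 1 : ℕ) : ℤ) + 1 = ((m + 2 : ℕ) : ℤ) := by push_cast; ring
      have e2 : ((m + 1 : ℕ) : ℤ) - 1 = (m : ℤ) := by push_cast; ring
      rw [e1, e2, hB, hc, zext_nat, zext_nat, zext_nat, zext_nat, zext_nat, hops.ttrr]
      simp
  have hTT : ∀ x y : ℂ, (∀ p : ℂ[X], p.eval (a * x + b * y) - p.eval (a * x - b * y) =
      2 * y * (qh q - (qh q)⁻¹) * (Dq (Sq p)).eval x) → ∀ n : ℤ,
      (zext P n).eval (a * x + b * y) - (zext P n).eval (a * x - b * y) =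
        2 * y * K n * (zext P (n - 1)).eval x := by
    intro x y h n
    rcases lt_or_ge n 0 with hn | hn
    · rw [zext_neg _ _ hn, hKneg n hn.le]; simp
    · lift n to ℕ using hn
      cases n with
      | zero => rw [hKneg ((0 : ℕ) : ℤ) (by simp), zext_nat, hops.p0]; simp
      | succ m =>
        have e2 : ((m + 1 : ℕ) : ℤ) - 1 = (m : ℤ) := by push_cast; ring
        rw [e2, hK, zext_nat, zext_nat, zext_nat, h, hk.2 m]
        simp; ring
  refine ⟨?_, ?_⟩
  · have : C (K 1 - b) = 0 := by
      apply aux_poly_ext ((q : ℂ) + 2 + (q : ℂ)⁻¹)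
      intro x hx1 hx2
      obtain ⟨y, hy, hyx, h⟩ := aux_point q hq0 hq1 Dq Sq hD hS x hx1 hx2
      rw [← ha, ← hb] at h
      have := hTT x y h 1
      simp [zext, hops.p0, hops.p1] at this
      rw [eval_C]
      apply mul_left_cancel₀ (mul_ne_zero two_ne_zero hy)
      linear_combination -this
    simpa [sub_eq_zero] using this
  · intro n hn
    generalize h0 : K (n + 2) - a * K (n + 1) - a * (K (n + 1) - a * K n) - b ^ 2 * K n = c0
    generalize h1 : K (n + 1) * (B (n + 1) - a * B n) - (a - 1) * (K (n + 1) - a * K n) * B n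
      - a * (K n * (B n - a * B (n - 1))) - b ^ 2 * K n * (B n + B (n - 1)) = c1
    generalize h2 : c (n + 1) * K n - a * K (n + 1) * c n - a * (K (n + 1) - a * K n) * c n
      - a * (K n * (B n - a * B (n - 1))) * B (n - 1)
      - a * (c n * K (n - 1) - a * K n * c (n - 1)) + B n * (K n * (B n - a * B (n - 1)))
      - b ^ 2 * K n * (c n + B (n - 1) ^ 2 + c (n - 1) - 1)
      + c n * (K n - a * K (n - 1)) = c2
    generalize h3 : - a * (K n * (B n - a * B (n - 1))) * c (n - 1)
      - a * (c n * K (n - 1) - a * K n * c (n - 1)) * B (n - 2)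
      + B n * (c n * K (n - 1) - a * K n * c (n - 1))
      - b ^ 2 * K n * c (n - 1) * (B (n - 1) + B (n - 2))
      + c n * (K (n - 1) * (B (n - 1) - a * B (n - 2))) = c3
    generalize h4 : - a * (c n * K (n - 1) - a * K n * c (n - 1)) * c (n - 2)
      - b ^ 2 * K n * c (n - 1) * c (n - 2)
      + c n * (c (n - 1) * K (n - 2) - a * K (n - 1) * c (n - 2)) = c4
    have main : C c0 * zext P (n + 1) + C c1 * zext P n + C c2 * zext P (n - 1)
        + C c3 * zext P (n - 2) + C c4 * zext P (n - 3) = 0 := by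
      apply aux_poly_ext ((q : ℂ) + 2 + (q : ℂ)⁻¹)
      intro x hx1 hx2
      obtain ⟨y, hy, hyx, h⟩ := aux_point q hq0 hq1 Dq Sq hD hS x hx1 hx2
      rw [← ha, ← hb] at h
      have := aux_master a b x y hy hyx (fun n => (zext P n).eval x)
        (fun n => (zext P n).eval (a * x + b * y)) (fun n => (zext P n).eval (a * x - b * y))
        B K c (fun n hn => by simp [zext_neg _ _ hn]) hKneg hcneg
        (fun n hn => by simp only [hrec n hn]; simp)
        (fun n hn => by simp only [hrec n hn]; simp)
        (fun n hn => by simp only [hrec n hn]; simp)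
        (hTT x y h) n hn
      rw [h0, h1, h2, h3, h4] at this
      simpa using this
    have ind := aux_indep P hops.monic hops.deg
    have z0 : c0 = 0 := ind (n + 1) (by omega) c0 c1 c2 c3 c4 (by
      rw [← main]; ring_nf)
    subst z0
    have z1 : c1 = 0 := ind n (by omega) c1 c2 c3 c4 0 (by
      rw [← main, C_0]; ring)
    subst z1
    refine ⟨rfl, rfl, ?_⟩
    rcases lt_or_ge n 1 with g | g
    · exact ⟨fun _ => by omega, fun _ => by omega, fun _ => by omega⟩
    have z2 : c2 = 0 := ind (n - 1) (by omega) c2 c3 c4 0 0 (by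
      rw [← main, C_0]; ring_nf)
    subst z2
    refine ⟨fun _ => rfl, ?_⟩
    rcases lt_or_ge n 2 with g | g
    · exact ⟨fun _ => by omega, fun _ => by omega⟩
    have z3 : c3 = 0 := ind (n - 2) (by omega) c3 c4 0 0 0 (by
      rw [← main, C_0]; ring_nf)
    subst z3
    refine ⟨fun _ => rfl, fun g => ?_⟩
    exact ind (n - 3) (by omega) c4 0 0 0 0 (by
      rw [← main, C_0]; ring_nf)

end Helpers2

section Helpers3

lemma aux_nec (q : ℝ) (hq0 : 0 < q) (hq1 : q < 1)
    (Dq Sq : ℂ[X] → ℂ[X]) (hD : IsAW q Dq) (hS : IsAv q Sq)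
    (P : ℕ → ℂ[X]) (Bn Co : ℕ → ℂ) (hops : MonicOPS P Bn Co) (k : ℕ → ℂ)
    (hk : AppellDS Dq Sq P k) :
    ((∀ n : ℕ, Bn n = 0) ∧ ∃ s : ℤ, (s = 1 ∨ s = -1) ∧
        ∀ n : ℕ, 1 ≤ n → Co n = (1 - (q : ℂ) ^ (2 * s * n)) / 4) ∧
      ∀ n : ℕ, 1 ≤ n → k n = gamn q (2 * n) / 2 := by
  have hqc : (q : ℂ) ≠ 0 := by exact_mod_cast hq0.ne'
  obtain ⟨a, ha⟩ : ∃ a : ℂ, a = ((q : ℂ) + (q : ℂ)⁻¹) / 2 := ⟨_, rfl⟩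
  obtain ⟨b, hb⟩ : ∃ b : ℂ, b = ((q : ℂ) - (q : ℂ)⁻¹) / 2 := ⟨_, rfl⟩
  obtain ⟨B, hB⟩ : ∃ B : ℤ → ℂ, B = zext Bn := ⟨_, rfl⟩
  obtain ⟨K, hK⟩ : ∃ K : ℤ → ℂ,
    K = zext (fun n => if n = 0 then 0 else k n * (qh q - (qh q)⁻¹)) := ⟨_, rfl⟩
  obtain ⟨c, hc⟩ : ∃ c : ℤ → ℂ, c = zext (fun n => if n = 0 then 0 else Co n) := ⟨_, rfl⟩
  obtain ⟨hK1, hrec⟩ := aux_rec q hq0 hq1 Dq Sq hD hS P Bn Co hops k hk a b ha hb B K c hB hK hc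
  have hab : a ^ 2 = b ^ 2 + 1 := by rw [ha, hb]; field_simp; ring
  -- nonvanishing facts
  obtain ⟨A, hA1, hA⟩ : ∃ A : ℝ, 1 < A ∧ a = A := by
    refine ⟨(q + q⁻¹) / 2, ?_, by rw [ha]; push_cast; ring⟩
    have h1 : q * q⁻¹ = 1 := mul_inv_cancel₀ hq0.ne'
    have h2 : 0 < q⁻¹ := inv_pos.2 hq0
    have h3 : 1 < q⁻¹ := by nlinarith
    nlinarith
  have ha0 : a ≠ 0 := by
    rw [hA]; exact_mod_cast (by linarith : A ≠ 0)
  have ha1 : a - 1 ≠ 0 := by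
    rw [hA]; exact_mod_cast (by linarith : A - 1 ≠ 0)
  have ha2 : 2 * a + 1 ≠ 0 := by
    rw [hA]; exact_mod_cast (by linarith : 2 * A + 1 ≠ 0)
  have ha4 : 4 * a ^ 2 - 1 ≠ 0 := by
    rw [hA]; exact_mod_cast (by nlinarith : 4 * A ^ 2 - 1 ≠ 0)
  have hb2 : b ^ 2 ≠ 0 := by
    have : b ^ 2 = a ^ 2 - 1 := by rw [hab]; ring
    rw [this, hA]; exact_mod_cast (by nlinarith : A ^ 2 - 1 ≠ 0)
  have hb0 : b ≠ 0 := by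
    intro h; apply hb2; rw [h]; ring
  have hK0 : K 0 = 0 := by rw [hK]; simp [zext]
  have hc0 : c 0 = 0 := by rw [hc]; simp [zext]
  have hcn : ∀ n : ℕ, c ((n + 1 : ℕ) : ℤ) = Co (n + 1) := by
    intro n; rw [hc, zext_nat]; simp
  have hBn : ∀ n : ℕ, B (n : ℤ) = Bn n := by
    intro n; rw [hB, zext_nat]
  have hKn : ∀ n : ℕ, K (n : ℤ) = ((q : ℂ) ^ n - ((q : ℂ) ^ n)⁻¹) / 2 := by
    intro n
    induction n using Nat.twoStepInduction with
    | zero => simpa using hK0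
    | one => simpa using hK1.trans hb
    | more n i1 i2 =>
      have h := (hrec n (by omega)).1
      push_cast at i2 ⊢
      rw [i1, i2] at h
      have hqn : (q : ℂ) ^ n ≠ 0 := pow_ne_zero _ hqc
      have e : K (n + 2) = 2 * a * (((q : ℂ) ^ (n + 1) - ((q : ℂ) ^ (n + 1))⁻¹) / 2)
          - (((q : ℂ) ^ n - ((q : ℂ) ^ n)⁻¹) / 2) := by
        linear_combination h - (((q : ℂ) ^ n - ((q : ℂ) ^ n)⁻¹) / 2) * hab
      rw [e, ha, pow_succ, pow_add]
      field_simp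
      ring
  have hKne : ∀ n : ℕ, K ((n + 1 : ℕ) : ℤ) ≠ 0 := by
    intro n h
    rw [hKn] at h
    have hqn : (q : ℂ) ^ (n + 1) ≠ 0 := pow_ne_zero _ hqc
    have h1 : ((q : ℂ) ^ (n + 1)) ^ 2 = 1 := by
      field_simp at h
      linear_combination h
    have h2 : (q ^ (n + 1)) ^ 2 = 1 := by exact_mod_cast h1
    have h3 : q ^ (n + 1) < 1 := pow_lt_one₀ hq0.le hq1 (by omega)
    have h4 : 0 < q ^ (n + 1) := by positivity
    nlinarith
  have hK2 : K 2 = 2 * a * b := by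
    have h := (hrec 0 le_rfl).1
    norm_num at h
    rw [hK0, hK1] at h
    linear_combination h
  have hK3 : K 3 = (4 * a ^ 2 - 1) * b := by
    have h := (hrec 1 (by norm_num)).1
    norm_num at h
    rw [hK2, hK1] at h
    linear_combination h - b * hab
  have hB1 : B 1 = (2 * a - 1) * B 0 := by
    have h := (hrec 0 le_rfl).2.1
    norm_num at h
    rw [hK0, hK1] at h
    apply mul_left_cancel₀ hb0
    linear_combination h
  have hB2 : B 2 = (4 * a ^ 2 - 2 * a - 1) * B 0 := by
    have h := (hrec 1 (by norm_num)).2.1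
    norm_num at h
    rw [hK2, hK1, hB1] at h
    apply mul_left_cancel₀ (mul_ne_zero (mul_ne_zero two_ne_zero ha0) hb0)
    linear_combination h - (b * ((2 * a - 1) * B 0 + B 0)) * hab
  have hB3 : B 3 = (8 * a ^ 3 - 4 * a ^ 2 - 4 * a + 1) * B 0 := by
    have h := (hrec 2 (by norm_num)).2.1
    norm_num at h
    rw [hK2, hK3, hB1, hB2] at h
    apply mul_left_cancel₀ (mul_ne_zero ha4 hb0)
    linear_combination h - (2 * a * b * ((4 * a ^ 2 - 2 * a - 1) * B 0 + (2 * a - 1) * B 0)) * hab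
  have hc1 : c 1 ≠ 0 := by
    have := hcn 0
    norm_num at this
    rw [this]; exact hops.Cne 1 le_rfl
  have hc2 : c 2 ≠ 0 := by
    have := hcn 1
    norm_num at this
    rw [this]; exact hops.Cne 2 (by norm_num)
  have E3 : 4 * a ^ 2 * c 3 * c 1 = (4 * a ^ 2 - 1) * c 2 * c 1 + c 3 * c 2 := by
    have h := (hrec 3 (by norm_num)).2.2.2.2 (by norm_num)
    norm_num at h
    rw [hK1, hK2, hK3] at h
    apply mul_left_cancel₀ hb0
    linear_combination -h + (4 * a ^ 2 - 1) * b * c 2 * c 1 * hab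
  have hB0 : B 0 = 0 := by
    by_contra hne
    have E1 : c 2 = 4 * a ^ 2 * c 1 := by
      have h := (hrec 2 (by norm_num)).2.2.2.1 (by norm_num)
      norm_num at h
      rw [hK1, hK2, hB1, hB2] at h
      apply mul_left_cancel₀ (mul_ne_zero (mul_ne_zero (mul_ne_zero ha2 ha1) hne) hb0)
      linear_combination h / 2 - (2 * a * b * c 1 * ((2 * a - 1) * B 0 + B 0)) / 2 * hab
    have E2 : 4 * a ^ 2 * c 3 = (4 * a ^ 2 - 1) ^ 2 * c 2 := by
      have h := (hrec 3 (by norm_num)).2.2.2.1 (by norm_num)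
      norm_num at h
      rw [hK2, hK3, hB1, hB2, hB3] at h
      apply mul_left_cancel₀ (mul_ne_zero (mul_ne_zero (mul_ne_zero ha2 ha1) hne) hb0)
      linear_combination h / 2 - ((4 * a ^ 2 - 1) * b * c 2 *
        ((4 * a ^ 2 - 2 * a - 1) * B 0 + (2 * a - 1) * B 0)) / 2 * hab
    have : (4 * a ^ 2 - 1) * c 2 * c 1 = 0 := by
      linear_combination -E3 - c 3 * E1
    exact mul_ne_zero (mul_ne_zero ha4 hc2) hc1 this
  have hBall : ∀ n : ℕ, Bn n = 0 := by
    intro n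
    rw [← hBn]
    induction n using Nat.twoStepInduction with
    | zero => simpa using hB0
    | one => simpa [hB0] using hB1
    | more n i1 i2 =>
      have h := (hrec (n + 1) (by omega)).2.1
      push_cast at i2 ⊢
      rw [show (n : ℤ) + 1 + 1 = n + 2 by ring, show (n : ℤ) + 1 - 1 = n by ring, i1, i2] at h
      have hne := hKne (n + 1)
      push_cast at hne
      rw [show (n : ℤ) + 1 + 1 = n + 2 by ring] at hne
      apply mul_left_cancel₀ hne
      linear_combination h
  have hrC : ∀ n : ℕ, c (n + 2) = (4 * a ^ 2 - 2) * c (n + 1) - c n - b ^ 2 := by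
    intro n
    have h := (hrec (n + 1) (by omega)).2.2.1 (by omega)
    have h1 := (hrec n (by omega)).1
    have b1 := (hBn (n + 1)).trans (hBall (n + 1))
    have b0 := (hBn n).trans (hBall n)
    push_cast at b1
    rw [show (n : ℤ) + 1 + 1 = n + 2 by ring, show (n : ℤ) + 1 - 1 = n by ring, b1, b0] at h
    have hne := hKne n
    push_cast at hne
    apply mul_left_cancel₀ hne
    linear_combination h + 2 * a * c (n + 1) * h1
      + (-K (n + 1) * c (n + 1) - K (n + 1) * c n - 2 * a * K n * c (n + 1)) * hab
  refine ⟨⟨hBall, ?_⟩, ?_⟩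
  · have e2 := hrC 0
    have e3 := hrC 1
    norm_num at e2 e3
    rw [hc0] at e2
    rw [e3, e2] at E3
    have hfin : (c 1 - (1 - (q : ℂ) ^ 2) / 4) * (c 1 - (1 - ((q : ℂ) ^ 2)⁻¹) / 4) = 0 := by
      have hprod : (c 1 - (1 - (q : ℂ) ^ 2) / 4) * (c 1 - (1 - ((q : ℂ) ^ 2)⁻¹) / 4) =
          c 1 ^ 2 + b ^ 2 * c 1 - b ^ 2 / 4 := by
        rw [hb]; field_simp; ring
      have hb' : b ^ 2 = a ^ 2 - 1 := by linear_combination -hab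
      rw [hprod]
      apply mul_left_cancel₀ (mul_ne_zero (mul_ne_zero (by norm_num : (4 : ℂ) ≠ 0) hb2) ha4)
      rw [hb'] at E3 ⊢
      linear_combination E3
    have key : ∀ z : ℂ, z ≠ 0 → 4 * a ^ 2 - 2 = z + z⁻¹ → c 1 = (1 - z) / 4 →
        ∀ n : ℕ, c n = (1 - z ^ n) / 4 := by
      intro z hz hza h1 n
      induction n using Nat.twoStepInduction with
      | zero => simpa using hc0
      | one => simpa using h1
      | more n i1 i2 =>
        have h := hrC n
        push_cast at i2 ⊢
        have hb' : b ^ 2 = (z + z⁻¹ - 2) / 4 := by linear_combination hza / 4 - hab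
        rw [h, i2, i1, hza, hb', pow_succ, pow_add]
        field_simp
        ring
    have hzq : 4 * a ^ 2 - 2 = (q : ℂ) ^ 2 + ((q : ℂ) ^ 2)⁻¹ := by
      rw [ha]; field_simp; ring
    have hq2 : (q : ℂ) ^ 2 ≠ 0 := pow_ne_zero _ hqc
    rcases mul_eq_zero.1 hfin with h | h
    · refine ⟨1, Or.inl rfl, fun n hn => ?_⟩
      have := key _ hq2 hzq (sub_eq_zero.1 h) n
      obtain ⟨m, rfl⟩ : ∃ m, n = m + 1 := ⟨n - 1, by omega⟩
      rw [hcn] at this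
      rw [this, mul_one, zpow_mul, zpow_natCast]
      norm_cast
    · refine ⟨-1, Or.inr rfl, fun n hn => ?_⟩
      have := key _ (inv_ne_zero hq2) (by rw [inv_inv, hzq]; ring) (sub_eq_zero.1 h) n
      obtain ⟨m, rfl⟩ : ∃ m, n = m + 1 := ⟨n - 1, by omega⟩
      rw [hcn] at this
      rw [this, zpow_mul, zpow_natCast, mul_neg_one, zpow_neg]
      norm_cast
  · intro n hn
    have h := hKn n
    rw [hK, zext_nat] at h
    rw [if_neg (by omega)] at h
    have hs := aux_qh_sub q hq0 hq1
    unfold gamn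
    rw [zpow_neg, zpow_mul, zpow_natCast]
    have : qh q ^ (2 : ℤ) = q := by rw [← aux_qh q hq0]; norm_cast
    rw [this, div_div, mul_comm _ (2 : ℂ), ← div_div, ← h, mul_div_assoc, div_self hs, mul_one]

end Helpers3

section Helpers4

lemma aux_suff (q : ℝ) (hq0 : 0 < q) (hq1 : q < 1)
    (Dq Sq : ℂ[X] → ℂ[X]) (hD : IsAW q Dq) (hS : IsAv q Sq)
    (P : ℕ → ℂ[X]) (B Co : ℕ → ℂ) (hops : MonicOPS P B Co) (hB : ∀ n : ℕ, B n = 0)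
    (r : ℂ) (hr : r = q ∨ r = (q : ℂ)⁻¹)
    (hC : ∀ n : ℕ, Co (n + 1) = (1 - r ^ (2 * (n + 1))) / 4) :
    AppellDS Dq Sq P (fun n => gamn q (2 * n) / 2) := by
  have hqc : (q : ℂ) ≠ 0 := by exact_mod_cast hq0.ne'
  have hs := aux_qh_sub q hq0 hq1
  have hr0 : r ≠ 0 := by
    rcases hr with h | h <;> rw [h]
    · exact hqc
    · exact inv_ne_zero hqc
  have p1 : P 1 = X := by rw [hops.p1, hB]; simp
  have tt : ∀ n : ℕ, P (n + 2) = X * P (n + 1) - C (Co (n + 1)) * P n := by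
    intro n; rw [hops.ttrr, hB]; simp
  have herm : ∀ w : ℂ, w ≠ 0 → ∀ n : ℕ,
      (P (n + 1)).eval ((q * w + (q : ℂ)⁻¹ * w⁻¹) / 2) -
        (P (n + 1)).eval (((q : ℂ)⁻¹ * w + q * w⁻¹) / 2) =
      ((q : ℂ) ^ (n + 1) - ((q : ℂ) ^ (n + 1))⁻¹) / 2 * (w - w⁻¹) *
        (P n).eval ((w + w⁻¹) / 2) := by
    intro w hw n
    have h1 := (aux_herm r hr0 w hw P Co hops.p0 p1 tt hC n).1
    have h2 := (aux_herm r hr0 w⁻¹ (inv_ne_zero hw) P Co hops.p0 p1 tt hC n).1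
    rw [inv_inv, add_comm w⁻¹ w] at h2
    rcases hr with h | h
    · rw [h] at h1 h2
      rw [add_comm ((q : ℂ) * w⁻¹)] at h2
      rw [h1, h2]; ring
    · rw [h, inv_inv] at h1 h2
      rw [add_comm ((q : ℂ)⁻¹ * w⁻¹)] at h2
      rw [h1, h2, inv_pow, inv_inv]; ring
  constructor
  · apply aux_poly_ext ((q : ℂ) + 2 + (q : ℂ)⁻¹)
    intro x hx1 hx2
    obtain ⟨y, hy, -, h⟩ := aux_point q hq0 hq1 Dq Sq hD hS x hx1 hx2
    have := h (P 0)
    rw [hops.p0] at this ⊢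
    simp only [eval_one, sub_self] at this
    exact (mul_eq_zero.1 this.symm).resolve_left
      (mul_ne_zero (mul_ne_zero two_ne_zero hy) hs)
  · intro n
    rw [← sub_eq_zero]
    apply aux_poly_ext ((q : ℂ) + 2 + (q : ℂ)⁻¹)
    intro x hx1 hx2
    obtain ⟨w, hw, hwx, h⟩ := aux_good_x q hq0 x
    obtain ⟨h1, h2, h3⟩ := h hx1 hx2
    have hww : w - w⁻¹ ≠ 0 := by
      intro h
      apply h1
      field_simp at h
      linear_combination h
    have e := aux_bridge q hq0 hq1 Dq Sq hD hS (P (n + 1)) w hw h1 h2 h3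
    rw [herm w hw n, hwx] at e
    rw [eval_sub, eval_mul, eval_C, sub_eq_zero]
    apply mul_right_cancel₀ (mul_ne_zero hs hww)
    rw [e]
    have hg : gamn q (2 * ((n + 1 : ℕ) : ℤ)) * (qh q - (qh q)⁻¹) =
        (q : ℂ) ^ (n + 1) - ((q : ℂ) ^ (n + 1))⁻¹ := by
      unfold gamn
      rw [div_mul_cancel₀ _ hs, zpow_neg, zpow_mul, zpow_natCast]
      have : qh q ^ (2 : ℤ) = q := by rw [← aux_qh q hq0]; norm_cast
      rw [this]
    rw [← hg]; ring

end Helpers4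

/-- a monic OPS satisfies `𝒟_q(𝒮_q P_n) = k_n P_{n-1}` for some constants
`k_n` iff `B_n = 0` for all `n` and `C_n = (1/4)(1 − q^{2sn})` for some `s = ±1`; in
this case `k_n = γ_{2n}/2` for `n ≥ 1` (and `k_0 = 0`), i.e. `(P_n)` is the monic
Rogers `q^{±2}`-Hermite sequence `Q_n(z; s q^{s/2}, −s q^{s/2} | q^s)`. -/
theorem stmt_17 (q : ℝ) (hq0 : 0 < q) (hq1 : q < 1)
    (Dq Sq : ℂ[X] → ℂ[X]) (hD : IsAW q Dq) (hS : IsAv q Sq)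
    (P : ℕ → ℂ[X]) (B Co : ℕ → ℂ) (hops : MonicOPS P B Co) :
    ((∃ k : ℕ → ℂ, k 0 = 0 ∧ AppellDS Dq Sq P k) ↔
      ((∀ n : ℕ, B n = 0) ∧ ∃ s : ℤ, (s = 1 ∨ s = -1) ∧
        ∀ n : ℕ, 1 ≤ n → Co n = (1 - (q : ℂ) ^ (2 * s * n)) / 4)) ∧
    (∀ k : ℕ → ℂ, AppellDS Dq Sq P k →
      ∀ n : ℕ, 1 ≤ n → k n = gamn q (2 * n) / 2) := by
  refine ⟨⟨?_, ?_⟩, ?_⟩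
  · rintro ⟨k, -, hk⟩
    exact (aux_nec q hq0 hq1 Dq Sq hD hS P B Co hops k hk).1
  · rintro ⟨hB, s, hs, hC⟩
    refine ⟨fun n => gamn q (2 * n) / 2, by simp [gamn], ?_⟩
    rcases hs with rfl | rfl
    · refine aux_suff q hq0 hq1 Dq Sq hD hS P B Co hops hB q (Or.inl rfl) fun n => ?_
      rw [hC (n + 1) (by omega)]
      norm_cast
    · refine aux_suff q hq0 hq1 Dq Sq hD hS P B Co hops hB (q : ℂ)⁻¹ (Or.inr rfl) fun n => ?_
      rw [hC (n + 1) (by omega), inv_pow, ← zpow_natCast, ← zpow_neg]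
      congr 3
  · intro k hk
    exact (aux_nec q hq0 hq1 Dq Sq hD hS P B Co hops k hk).2
end

section
/- Let u be a regular linear functional on ℂ[z] whose monic OPS (P_n)_{n≥0} satisfies 𝒟_q(𝒮_q P_n) = k_n P_{n−1} for all n ≥ 0, for some constants k_n ∈ ℂ. Then there exists s ∈ {1, −1} such that u satisfies the four functional equations: q^{s/2}(q^s − 1)·𝐒_q(𝐃_q u) = 2·(z·u); 4(α² − 1)q^{5s/2}·𝐃_q(𝐃_q((z² − α²)·u)) = (−4z² + 1 − q^{2s})·u; 4q^{2s}·𝐒_q(𝐒_q u) = (−4z² + 1 + 3q^{2s})·u; and 2q^{3s}(1 − q^s)·𝐃_q(𝐒_q((z² − α²)·u)) = (z·(−4z² + q^{4s} + q^{2s} + 2))·u. -/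
open Polynomial

theorem poly_ext_w (t : ℂ) (ht : t ≠ 0) (p r : ℂ[X])
    (h : ∀ w : ℂ, w ≠ 0 → w ^ 2 - 1 ≠ 0 → (t * w) ^ 2 - 1 ≠ 0 → w ^ 2 - t ^ 2 ≠ 0 →
      p.eval ((w + w⁻¹) / 2) = r.eval ((w + w⁻¹) / 2)) : p = r := by
  apply Polynomial.eq_of_infinite_eval_eq
  have hfin : Set.Finite ({1, -1, (t + t⁻¹) / 2, -((t + t⁻¹) / 2)} : Set ℂ) := by simp
  refine Set.Infinite.mono ?_ hfin.infinite_compl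
  intro x hx
  simp only [Set.mem_compl_iff, Set.mem_insert_iff, Set.mem_singleton_iff, not_or] at hx
  obtain ⟨h1, h2, h3, h4⟩ := hx
  obtain ⟨y, hy⟩ := IsAlgClosed.exists_pow_nat_eq (x ^ 2 - 1) (n := 2) (by norm_num)
  have hprod : (x + y) * (x - y) = 1 := by linear_combination -hy
  have hne : x + y ≠ 0 := left_ne_zero_of_mul_eq_one hprod
  have hinv : (x + y)⁻¹ = x - y := by
    rw [inv_eq_iff_eq_inv]; exact eq_inv_of_mul_eq_one_left hprod
  have hxx : ((x + y) + (x + y)⁻¹) / 2 = x := by rw [hinv]; ring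
  have key := h (x + y) hne ?_ ?_ ?_
  · rw [hxx] at key; exact key
  · intro h0
    have : (x + y - 1) * (x + y + 1) = 0 := by linear_combination h0
    rcases mul_eq_zero.1 this with h' | h'
    · have : x + y = 1 := by linear_combination h'
      rw [this] at hxx; apply h1; rw [← hxx]; norm_num
    · have : x + y = -1 := by linear_combination h'
      rw [this] at hxx; apply h2; rw [← hxx]; norm_num
  · intro h0
    have : (t * (x + y) - 1) * (t * (x + y) + 1) = 0 := by linear_combination h0
    rcases mul_eq_zero.1 this with h' | h'
    · have : x + y = t⁻¹ := by
        field_simp; linear_combination h'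
      rw [this] at hxx; apply h3; rw [← hxx, inv_inv]; ring
    · have : x + y = -t⁻¹ := by
        field_simp; linear_combination h'
      rw [this] at hxx; apply h4; rw [← hxx, inv_neg, inv_inv]; ring
  · intro h0
    have : (x + y - t) * (x + y + t) = 0 := by linear_combination h0
    rcases mul_eq_zero.1 this with h' | h'
    · have : x + y = t := by linear_combination h'
      rw [this] at hxx; apply h3; rw [← hxx]
    · have : x + y = -t := by linear_combination h'
      rw [this] at hxx; apply h4; rw [← hxx, inv_neg]; ring

section ops
variable {q : ℝ} {Dq Sq : ℂ[X] → ℂ[X]}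

/-- shifted evaluation -/
noncomputable def shv (f : ℂ[X]) (w : ℂ) : ℂ := f.eval ((w + w⁻¹) / 2)

theorem shv_D (ht : qh q ≠ 0) (hq : (qh q) ^ 2 - 1 ≠ 0)
    (hD : IsAW q Dq) (f : ℂ[X]) (w : ℂ) (hw : w ≠ 0) (hw1 : w ^ 2 - 1 ≠ 0) :
    shv (Dq f) w = (shv f (qh q * w) - shv f ((qh q)⁻¹ * w)) *
      (2 * qh q * w / (((qh q) ^ 2 - 1) * (w ^ 2 - 1))) := by
  have := hD f w hw (sub_ne_zero.1 hw1)
  unfold shv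
  rw [this, mul_inv, mul_inv, inv_inv, div_eq_mul_inv]
  congr 1
  generalize qh q = t at *
  have e1 : (t - t⁻¹) = (t ^ 2 - 1) / t := by field_simp
  have e2 : (w - w⁻¹) = (w ^ 2 - 1) / w := by field_simp
  rw [e1, e2]
  field_simp

theorem shv_S (hS : IsAv q Sq) (f : ℂ[X]) (w : ℂ) (hw : w ≠ 0) (hw1 : w ^ 2 - 1 ≠ 0) :
    shv (Sq f) w = (shv f (qh q * w) + shv f ((qh q)⁻¹ * w)) / 2 := by
  have := hS f w hw (sub_ne_zero.1 hw1)
  unfold shv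
  rw [this, mul_inv, mul_inv, inv_inv]

theorem aux_h3 (ht : qh q ≠ 0) (w : ℂ)
    (h3 : w ^ 2 - (qh q) ^ 2 ≠ 0) : ((qh q)⁻¹ * w) ^ 2 - 1 ≠ 0 := by
  intro h
  apply h3
  field_simp at h
  linear_combination h

theorem aux_eqs (ht : qh q ≠ 0) (w : ℂ)
    (hw : w ≠ 0) : qh q * ((qh q)⁻¹ * w) = w ∧ (qh q)⁻¹ * (qh q * w) = w ∧ qh q * w ≠ 0 ∧
    (qh q)⁻¹ * w ≠ 0 := by
  refine ⟨by field_simp, by field_simp, mul_ne_zero ht hw, mul_ne_zero (inv_ne_zero ht) hw⟩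

theorem shv_DS (ht : qh q ≠ 0) (hq : (qh q) ^ 2 - 1 ≠ 0) (hD : IsAW q Dq) (hS : IsAv q Sq) (f : ℂ[X]) (w : ℂ)
    (hw : w ≠ 0) (h1 : w ^ 2 - 1 ≠ 0) (h2 : (qh q * w) ^ 2 - 1 ≠ 0) (h3 : w ^ 2 - (qh q) ^ 2 ≠ 0) : shv (Dq (Sq f)) w =
    (shv f (qh q * (qh q * w)) - shv f ((qh q)⁻¹ * ((qh q)⁻¹ * w))) *
      (qh q * w / (((qh q) ^ 2 - 1) * (w ^ 2 - 1))) := by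
  obtain ⟨e1, e2, e3, e4⟩ := aux_eqs ht w hw
  rw [shv_D ht hq hD _ w hw h1, shv_S hS _ _ e3 h2, shv_S hS _ _ e4 (aux_h3 ht w h3), e1, e2]
  ring

theorem shv_SS (ht : qh q ≠ 0) (hS : IsAv q Sq) (f : ℂ[X]) (w : ℂ)
    (hw : w ≠ 0) (h1 : w ^ 2 - 1 ≠ 0) (h2 : (qh q * w) ^ 2 - 1 ≠ 0) (h3 : w ^ 2 - (qh q) ^ 2 ≠ 0) : shv (Sq (Sq f)) w =
    (shv f (qh q * (qh q * w)) + 2 * shv f w + shv f ((qh q)⁻¹ * ((qh q)⁻¹ * w))) / 4 := by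
  obtain ⟨e1, e2, e3, e4⟩ := aux_eqs ht w hw
  rw [shv_S hS _ w hw h1, shv_S hS _ _ e3 h2, shv_S hS _ _ e4 (aux_h3 ht w h3), e1, e2]
  ring

theorem shv_DD (ht : qh q ≠ 0) (hq : (qh q) ^ 2 - 1 ≠ 0) (hD : IsAW q Dq) (f : ℂ[X]) (w : ℂ)
    (hw : w ≠ 0) (h1 : w ^ 2 - 1 ≠ 0) (h2 : (qh q * w) ^ 2 - 1 ≠ 0) (h3 : w ^ 2 - (qh q) ^ 2 ≠ 0) : shv (Dq (Dq f)) w =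
    ((shv f (qh q * (qh q * w)) - shv f w) *
        (2 * qh q * (qh q * w) / (((qh q) ^ 2 - 1) * ((qh q * w) ^ 2 - 1)))
      - (shv f w - shv f ((qh q)⁻¹ * ((qh q)⁻¹ * w))) *
        (2 * qh q ^ 2 * w / (((qh q) ^ 2 - 1) * (w ^ 2 - (qh q) ^ 2)))) *
      (2 * qh q * w / (((qh q) ^ 2 - 1) * (w ^ 2 - 1))) := by
  obtain ⟨e1, e2, e3, e4⟩ := aux_eqs ht w hw
  have h3' := aux_h3 ht w h3
  rw [shv_D ht hq hD _ w hw h1, shv_D ht hq hD _ _ e3 h2, shv_D ht hq hD _ _ e4 h3', e1, e2]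
  congr 3
  have : ((qh q)⁻¹ * w) ^ 2 - 1 = (w ^ 2 - (qh q) ^ 2) / (qh q) ^ 2 := by field_simp
  rw [this]
  field_simp

theorem shv_SD (ht : qh q ≠ 0) (hq : (qh q) ^ 2 - 1 ≠ 0) (hD : IsAW q Dq) (hS : IsAv q Sq) (f : ℂ[X]) (w : ℂ)
    (hw : w ≠ 0) (h1 : w ^ 2 - 1 ≠ 0) (h2 : (qh q * w) ^ 2 - 1 ≠ 0) (h3 : w ^ 2 - (qh q) ^ 2 ≠ 0) : shv (Sq (Dq f)) w =
    ((shv f (qh q * (qh q * w)) - shv f w) *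
        (2 * qh q * (qh q * w) / (((qh q) ^ 2 - 1) * ((qh q * w) ^ 2 - 1)))
      + (shv f w - shv f ((qh q)⁻¹ * ((qh q)⁻¹ * w))) *
        (2 * qh q ^ 2 * w / (((qh q) ^ 2 - 1) * (w ^ 2 - (qh q) ^ 2)))) / 2 := by
  obtain ⟨e1, e2, e3, e4⟩ := aux_eqs ht w hw
  have h3' := aux_h3 ht w h3
  rw [shv_S hS _ w hw h1, shv_D ht hq hD _ _ e3 h2, shv_D ht hq hD _ _ e4 h3', e1, e2]
  congr 3
  have : ((qh q)⁻¹ * w) ^ 2 - 1 = (w ^ 2 - (qh q) ^ 2) / (qh q) ^ 2 := by field_simp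
  rw [this]
  field_simp

theorem shv_add (f g : ℂ[X]) (w : ℂ) : shv (f + g) w = shv f w + shv g w := by simp [shv]
theorem shv_sub (f g : ℂ[X]) (w : ℂ) : shv (f - g) w = shv f w - shv g w := by simp [shv]
theorem shv_mul (f g : ℂ[X]) (w : ℂ) : shv (f * g) w = shv f w * shv g w := by simp [shv]
theorem shv_pow (f : ℂ[X]) (n : ℕ) (w : ℂ) : shv (f ^ n) w = shv f w ^ n := by simp [shv]
theorem shv_C (c : ℂ) (w : ℂ) : shv (C c) w = c := by simp [shv]
theorem shv_one (w : ℂ) : shv 1 w = 1 := by simp [shv]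
theorem shv_X (w : ℂ) : shv X w = (w + w⁻¹) / 2 := by simp [shv]

theorem L_add (ht : qh q ≠ 0) (hq : (qh q) ^ 2 - 1 ≠ 0) (hD : IsAW q Dq) (hS : IsAv q Sq) (f g : ℂ[X]) : Dq (Sq (f + g)) = Dq (Sq f) + Dq (Sq g) := by
  apply poly_ext_w (qh q) ht
  intro w hw h1 h2 h3
  change shv _ w = shv _ w
  rw [shv_add, shv_DS ht hq hD hS _ w hw h1 h2 h3, shv_DS ht hq hD hS _ w hw h1 h2 h3,
    shv_DS ht hq hD hS _ w hw h1 h2 h3, shv_add, shv_add]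
  ring

theorem L_smul (ht : qh q ≠ 0) (hq : (qh q) ^ 2 - 1 ≠ 0) (hD : IsAW q Dq) (hS : IsAv q Sq) (c : ℂ) (g : ℂ[X]) : Dq (Sq (C c * g)) = C c * Dq (Sq g) := by
  apply poly_ext_w (qh q) ht
  intro w hw h1 h2 h3
  change shv _ w = shv _ w
  rw [shv_mul, shv_DS ht hq hD hS _ w hw h1 h2 h3, shv_DS ht hq hD hS _ w hw h1 h2 h3,
    shv_mul, shv_mul, shv_C, shv_C, shv_C]
  ring

/-- the constant `a = 2 α² - 1` -/
noncomputable def aa (q : ℝ) : ℂ := 2 * alp q ^ 2 - 1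

theorem id1 (ht : qh q ≠ 0) (hq : (qh q) ^ 2 - 1 ≠ 0) (hD : IsAW q Dq) (hS : IsAv q Sq) (f : ℂ[X]) : Dq (Sq (X * f)) = C (aa q) * (X * Dq (Sq f)) +
    C (alp q) * (C 2 * Sq (Sq f) - f) := by
  apply poly_ext_w (qh q) ht
  intro w hw h1 h2 h3
  change shv _ w = shv _ w
  simp only [shv_add, shv_sub, shv_mul, shv_C, shv_DS ht hq hD hS _ w hw h1 h2 h3,
    shv_SS ht hS _ w hw h1 h2 h3, shv_X, aa, alp]
  generalize shv f (qh q * (qh q * w)) = F2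
  generalize shv f ((qh q)⁻¹ * ((qh q)⁻¹ * w)) = F3
  generalize shv f w = F0
  generalize qh q = t at *
  field_simp
  ring

theorem id2 (ht : qh q ≠ 0) (hq : (qh q) ^ 2 - 1 ≠ 0) (hD : IsAW q Dq) (hS : IsAv q Sq) (f : ℂ[X]) : C 2 * Sq (Sq (X * f)) - X * f =
    C (aa q) * (X * (C 2 * Sq (Sq f) - f)) +
    C (4 * (alp q ^ 2 - 1) * alp q) * ((X ^ 2 - 1) * Dq (Sq f)) := by
  apply poly_ext_w (qh q) ht
  intro w hw h1 h2 h3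
  change shv _ w = shv _ w
  simp only [shv_add, shv_sub, shv_mul, shv_C, shv_pow, shv_one, shv_DS ht hq hD hS _ w hw h1 h2 h3,
    shv_SS ht hS _ w hw h1 h2 h3, shv_X, aa, alp]
  generalize shv f (qh q * (qh q * w)) = F2
  generalize shv f ((qh q)⁻¹ * ((qh q)⁻¹ * w)) = F3
  generalize shv f w = F0
  generalize qh q = t at *
  field_simp
  ring

theorem id3 (ht : qh q ≠ 0) (hq : (qh q) ^ 2 - 1 ≠ 0) (hD : IsAW q Dq) (hS : IsAv q Sq) (f : ℂ[X]) : C (2 * (alp q ^ 2 - 1)) * ((X ^ 2 - C (alp q ^ 2)) * Dq (Dq f)) =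
    C (alp q) * (C 2 * Sq (Sq f) - f - f) - C (2 * (alp q ^ 2 - 1)) * (X * Dq (Sq f)) := by
  apply poly_ext_w (qh q) ht
  intro w hw h1 h2 h3
  change shv _ w = shv _ w
  simp only [shv_add, shv_sub, shv_mul, shv_C, shv_pow, shv_one, shv_DS ht hq hD hS _ w hw h1 h2 h3,
    shv_SS ht hS _ w hw h1 h2 h3, shv_DD ht hq hD _ w hw h1 h2 h3, shv_X, alp]
  generalize shv f (qh q * (qh q * w)) = F2
  generalize shv f ((qh q)⁻¹ * ((qh q)⁻¹ * w)) = F3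
  generalize shv f w = F0
  generalize qh q = t at *
  have e1 : t * (t * (w * w)) - 1 ≠ 0 := by intro h; apply h2; linear_combination h
  have e2 : t ^ 2 * w ^ 2 - 1 ≠ 0 := by intro h; apply h2; linear_combination h
  field_simp
  ring

theorem id4 (ht : qh q ≠ 0) (hq : (qh q) ^ 2 - 1 ≠ 0) (hD : IsAW q Dq) (hS : IsAv q Sq) (f : ℂ[X]) : C 2 * ((X ^ 2 - C (alp q ^ 2)) * Sq (Dq f)) =
    C (2 * alp q) * ((X ^ 2 - 1) * Dq (Sq f)) - X * (C 2 * Sq (Sq f) - f - f) := by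
  apply poly_ext_w (qh q) ht
  intro w hw h1 h2 h3
  change shv _ w = shv _ w
  simp only [shv_add, shv_sub, shv_mul, shv_C, shv_pow, shv_one, shv_DS ht hq hD hS _ w hw h1 h2 h3,
    shv_SS ht hS _ w hw h1 h2 h3, shv_SD ht hq hD hS _ w hw h1 h2 h3, shv_X, alp]
  generalize shv f (qh q * (qh q * w)) = F2
  generalize shv f ((qh q)⁻¹ * ((qh q)⁻¹ * w)) = F3
  generalize shv f w = F0
  generalize qh q = t at *
  obtain ⟨d, hd⟩ : ∃ d, d = (t * w) ^ 2 - 1 := ⟨_, rfl⟩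
  rw [← hd] at h2 ⊢
  field_simp
  rw [hd]
  ring

theorem SS_one (ht : qh q ≠ 0) (hS : IsAv q Sq) : C 2 * Sq (Sq 1) - 1 = (1 : ℂ[X]) := by
  apply poly_ext_w (qh q) ht
  intro w hw h1 h2 h3
  change shv _ w = shv _ w
  simp only [shv_sub, shv_mul, shv_C, shv_one, shv_SS ht hS _ w hw h1 h2 h3]
  norm_num

end ops

theorem cubic_zero {c3 c2 c1 c0 : ℂ}
    (h : C c3 * X ^ 3 + C c2 * X ^ 2 + C c1 * X + C c0 = (0 : ℂ[X])) :
    c3 = 0 ∧ c2 = 0 ∧ c1 = 0 ∧ c0 = 0 := by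
  have h3 := congrArg (fun p => coeff p 3) h
  have h2 := congrArg (fun p => coeff p 2) h
  have h1 := congrArg (fun p => coeff p 1) h
  have h0 := congrArg (fun p => coeff p 0) h
  simp [coeff_X, coeff_C, coeff_X_pow] at h3 h2 h1 h0
  exact ⟨h3, h2, h1, h0⟩

section opsq
variable {u : ℂ[X] →ₗ[ℂ] ℂ} {P : ℕ → ℂ[X]}

theorem u_C (c : ℂ) (f : ℂ[X]) : u (C c * f) = c * u f := by
  rw [← smul_eq_C_mul, map_smul, smul_eq_mul]

theorem span_P (hmonic : ∀ n, (P n).Monic) (hdeg : ∀ n, (P n).natDegree = n) :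
    Submodule.span ℂ (Set.range P) = ⊤ := by
  let S : Polynomial.Sequence ℂ :=
    ⟨P, fun n => by rw [degree_eq_natDegree (hmonic n).ne_zero, hdeg]⟩
  exact S.span (fun i => by
    have : (S i).leadingCoeff = 1 := hmonic i
    rw [this]; exact isUnit_one)

theorem reg_zero (hmonic : ∀ n, (P n).Monic) (hdeg : ∀ n, (P n).natDegree = n)
    (horth : ∀ m n : ℕ, m ≠ n → u (P m * P n) = 0)
    (hreg : ∀ n : ℕ, u (P n ^ 2) ≠ 0) (G : ℂ[X]) (hG : ∀ f, u (G * f) = 0) : G = 0 := by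
  have hmem : G ∈ Submodule.span ℂ (Set.range P) := by
    rw [span_P hmonic hdeg]; trivial
  obtain ⟨c, hc⟩ := (Finsupp.mem_span_range_iff_exists_finsupp).1 hmem
  have hc0 : c = 0 := by
    ext m
    have h := hG (P m)
    rw [← hc, Finsupp.sum, Finset.sum_mul, map_sum] at h
    rw [Finset.sum_eq_single m] at h
    · rw [smul_mul_assoc, map_smul, smul_eq_mul, ← pow_two] at h
      rcases mul_eq_zero.1 h with h | h
      · simpa using h
      · exact absurd h (hreg m)
    · intro i _ hi
      rw [smul_mul_assoc, map_smul, horth i m hi, smul_zero]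
    · intro hm
      rw [Finsupp.notMem_support_iff.1 hm]; simp
  rw [← hc, hc0]; simp

theorem dual_P (hmonic : ∀ n, (P n).Monic) (hdeg : ∀ n, (P n).natDegree = n)
    (horth : ∀ m n : ℕ, m ≠ n → u (P m * P n) = 0)
    (hreg : ∀ n : ℕ, u (P n ^ 2) ≠ 0) (L : ℂ[X] →ₗ[ℂ] ℂ[X]) (k : ℕ → ℂ)
    (hL0 : L (P 0) = 0) (hL : ∀ n, L (P (n + 1)) = C (k (n + 1)) * P n) (m : ℕ) (f : ℂ[X]) :
    u (P m * L f) = k (m + 1) * u (P m ^ 2) / u (P (m + 1) ^ 2) * u (P (m + 1) * f) := by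
  have key : u ∘ₗ LinearMap.mulLeft ℂ (P m) ∘ₗ L =
      (k (m + 1) * u (P m ^ 2) / u (P (m + 1) ^ 2)) • (u ∘ₗ LinearMap.mulLeft ℂ (P (m + 1))) := by
    apply LinearMap.ext_on_range (span_P hmonic hdeg)
    intro n
    simp only [LinearMap.comp_apply, LinearMap.mulLeft_apply, LinearMap.smul_apply, smul_eq_mul]
    rcases n with _ | n
    · rw [hL0, horth (m + 1) 0 (by omega)]; simp
    · rw [hL, mul_left_comm, u_C]
      by_cases hmn : m = n
      · subst hmn
        rw [← pow_two, ← pow_two]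
        have := hreg (m + 1)
        field_simp
      · rw [horth m n hmn, horth (m + 1) (n + 1) (by omega)]; simp
  exact LinearMap.congr_fun key f

theorem core (hmonic : ∀ n, (P n).Monic) (hdeg : ∀ n, (P n).natDegree = n)
    (horth : ∀ m n : ℕ, m ≠ n → u (P m * P n) = 0)
    (hreg : ∀ n : ℕ, u (P n ^ 2) ≠ 0) (L : ℂ[X] →ₗ[ℂ] ℂ[X]) (T : ℂ[X] → ℂ[X]) (k : ℕ → ℂ)
    (hL0 : L (P 0) = 0) (hL : ∀ n, L (P (n + 1)) = C (k (n + 1)) * P n)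
    (al a g : ℂ) (hT1 : T 1 = 1)
    (hI1 : ∀ f, L (X * f) = C a * (X * L f) + C al * T f)
    (hI2 : ∀ f, T (X * f) = C a * (X * T f) + C g * ((X ^ 2 - 1) * L f))
    (hag : al * g = a ^ 2 - 1) (hal : al ≠ 0) (ha : a ≠ 0) (ha1 : a - 1 ≠ 0) (ha2 : 2 * a + 1 ≠ 0)
    (ha3 : 4 * a ^ 2 - 1 ≠ 0) (ha4 : 1 - a ^ 2 ≠ 0) :
    ∃ r r3 K0 K1 K2 : ℂ, r ^ 2 - r * (a ^ 2 - 1) - (a ^ 2 - 1) / 4 = 0 ∧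
      r3 = (4 * a ^ 2 - 1) * r + (a ^ 2 - 1) ∧
      K0 * (-r) = al ∧ K1 * (r - r3) = 2 * a * al ∧ K0 - 2 * a * K1 + K2 = 0 ∧
      (∀ f, u (L f) = K0 * u (X * f)) ∧
      (∀ f, u (X * L f) = K1 * u (X ^ 2 * f) + K1 * r * u f) ∧
      (∀ f, u (X ^ 2 * L f) = K2 * u (X ^ 3 * f) + (K2 * r3 - r * K0) * u (X * f)) := by
  have hP0 : P 0 = 1 := by
    have := (hmonic 0).as_sum; rw [hdeg] at this; simpa using this
  have hL1 : L 1 = 0 := by rw [← hP0, hL0]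
  have hLX : L X = C al := by
    have := hI1 1; rw [hL1, hT1] at this; simpa using this
  have hTX : T X = C a * X := by
    have := hI2 1; rw [hL1, hT1] at this; simpa using this
  have hLX2 : L (X ^ 2) = C (2 * a * al) * X := by
    have := hI1 X; rw [hLX, hTX] at this
    rw [pow_two, this]; simp only [map_mul, map_ofNat]; ring
  have hTX2 : T (X ^ 2) = C (2 * a ^ 2 - 1) * X ^ 2 - C (a ^ 2 - 1) := by
    have := hI2 X; rw [hLX, hTX] at this
    have hg : C al * C g = (C a ^ 2 - 1 : ℂ[X]) := by
      rw [← map_mul, hag]; simp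
    rw [pow_two, this]; simp only [map_mul, map_ofNat, map_sub, map_pow, map_one]
    linear_combination (X ^ 2 - 1) * hg
  have hLX3 : L (X ^ 3) = C al * (C (4 * a ^ 2 - 1) * X ^ 2 - C (a ^ 2 - 1)) := by
    have := hI1 (X ^ 2); rw [hLX2, hTX2] at this
    rw [pow_succ' X 2, this]; simp only [map_mul, map_ofNat, map_sub, map_pow, map_one]; ring
  have hTX3 : T (X ^ 3) = C (4 * a ^ 3 - 3 * a) * X ^ 3 - C (3 * a * (a ^ 2 - 1)) * X := by
    have := hI2 (X ^ 2); rw [hLX2, hTX2] at this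
    have hg : C al * C g = (C a ^ 2 - 1 : ℂ[X]) := by
      rw [← map_mul, hag]; simp
    rw [pow_succ' X 2, this]; simp only [map_mul, map_ofNat, map_sub, map_pow, map_one]
    linear_combination (X ^ 2 - 1) * 2 * C a * X * hg
  have hLX4 : L (X ^ 4) = C al * (C (8 * a ^ 3 - 4 * a) * X ^ 3 - C (4 * a * (a ^ 2 - 1)) * X) := by
    have := hI1 (X ^ 3); rw [hLX3, hTX3] at this
    rw [pow_succ' X 3, this]; simp only [map_mul, map_ofNat, map_sub, map_pow, map_one]; ring
  have hLC : ∀ c f, L (C c * f) = C c * L f := by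
    intro c f; rw [← smul_eq_C_mul, map_smul, smul_eq_C_mul]
  have hLc : ∀ c, L (C c) = 0 := by
    intro c; rw [← mul_one (C c), hLC, hL1, mul_zero]
  obtain ⟨b, hP1⟩ : ∃ b, P 1 = X - C b := by
    have := (hmonic 1).as_sum; rw [hdeg] at this
    refine ⟨-(P 1).coeff 0, ?_⟩
    conv_lhs => rw [this]
    simp
  obtain ⟨p2, r, hP2⟩ : ∃ p2 r, P 2 = X ^ 2 + C p2 * X + C r := by
    have := (hmonic 2).as_sum; rw [hdeg] at this
    refine ⟨(P 2).coeff 1, (P 2).coeff 0, ?_⟩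
    conv_lhs => rw [this]
    simp [Finset.sum_range_succ]; ring
  obtain ⟨p3, r3, s3, hP3⟩ : ∃ p3 r3 s3, P 3 = X ^ 3 + C p3 * X ^ 2 + C r3 * X + C s3 := by
    have := (hmonic 3).as_sum; rw [hdeg] at this
    refine ⟨(P 3).coeff 2, (P 3).coeff 1, (P 3).coeff 0, ?_⟩
    conv_lhs => rw [this]
    simp [Finset.sum_range_succ]; ring
  obtain ⟨p4, r4, s4, v4, hP4⟩ : ∃ p4 r4 s4 v4,
      P 4 = X ^ 4 + C p4 * X ^ 3 + C r4 * X ^ 2 + C s4 * X + C v4 := by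
    have := (hmonic 4).as_sum; rw [hdeg] at this
    refine ⟨(P 4).coeff 3, (P 4).coeff 2, (P 4).coeff 1, (P 4).coeff 0, ?_⟩
    conv_lhs => rw [this]
    simp [Finset.sum_range_succ]; ring
  have hk1 : k 1 = al := by
    have h := hL 0
    rw [hP0, zero_add, hP1, map_sub, hLX, hLc] at h
    simpa using h.symm
  have hk2 : k 2 = 2 * a * al ∧ p2 = -(2 * a * b) := by
    have h := hL 1
    norm_num only at h
    rw [hP1, hP2, map_add, map_add, hLC, hLX, hLc, hLX2] at h
    have h' : C 0 * X ^ 3 + C 0 * X ^ 2 + C (k 2 - 2 * a * al) * X + C (-(k 2 * b) - p2 * al)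
        = (0 : ℂ[X]) := by
      simp only [map_mul, map_ofNat, map_sub, map_neg, map_zero] at h ⊢
      linear_combination -h
    obtain ⟨-, -, h1, h2⟩ := cubic_zero h'
    have hk : k 2 = 2 * a * al := by linear_combination h1
    refine ⟨hk, ?_⟩
    rw [hk] at h2
    apply mul_left_cancel₀ hal
    linear_combination -h2
  obtain ⟨hk2, hp2⟩ := hk2
  have hk3 : k 3 = (4 * a ^ 2 - 1) * al ∧ p3 = -((4 * a ^ 2 - 1) * b) ∧
      r3 = (4 * a ^ 2 - 1) * r + (a ^ 2 - 1) := by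
    have h := hL 2
    norm_num only at h
    rw [hP2, hP3, map_add, map_add, map_add, hLC, hLC, hLX, hLc, hLX2, hLX3] at h
    have h' : C 0 * X ^ 3 + C (k 3 - (4 * a ^ 2 - 1) * al) * X ^ 2
        + C (k 3 * p2 - p3 * (2 * a * al)) * X + C (k 3 * r + al * (a ^ 2 - 1) - r3 * al)
        = (0 : ℂ[X]) := by
      simp only [map_mul, map_ofNat, map_sub, map_add, map_pow, map_one, map_neg, map_zero] at h ⊢
      linear_combination -h
    obtain ⟨-, h1, h2, h3⟩ := cubic_zero h'
    have hk : k 3 = (4 * a ^ 2 - 1) * al := by linear_combination h1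
    rw [hk] at h2 h3
    refine ⟨hk, ?_, ?_⟩
    · rw [hp2] at h2
      apply mul_left_cancel₀ (mul_ne_zero (mul_ne_zero two_ne_zero ha) hal)
      linear_combination -h2
    · apply mul_left_cancel₀ hal
      linear_combination -h3
  obtain ⟨hk3, hp3, hr3⟩ := hk3
  have hd := dual_P hmonic hdeg horth hreg L k hL0 hL
  have hd0 := hd 0
  have hd1 := hd 1
  have hd2 := hd 2
  norm_num only at hd0 hd1 hd2
  have hh0 := hreg 0
  have hh1 := hreg 1
  have hh2 := hreg 2
  have hh3 := hreg 3
  have hK0h : k 1 * u (P 0 ^ 2) / u (P 1 ^ 2) * u (P 1 ^ 2) = al * u (P 0 ^ 2) := by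
    rw [hk1]; field_simp
  have hK1h : k 2 * u (P 1 ^ 2) / u (P 2 ^ 2) * u (P 2 ^ 2) = 2 * a * al * u (P 1 ^ 2) := by
    rw [hk2]; field_simp
  have hK2h : k 3 * u (P 2 ^ 2) / u (P 3 ^ 2) * u (P 3 ^ 2) =
      (4 * a ^ 2 - 1) * al * u (P 2 ^ 2) := by
    rw [hk3]; field_simp
  have hK2ne : k 3 * u (P 2 ^ 2) / u (P 3 ^ 2) ≠ 0 := by
    rw [hk3]
    exact div_ne_zero (mul_ne_zero (mul_ne_zero ha3 hal) hh2) hh3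
  generalize k 1 * u (P 0 ^ 2) / u (P 1 ^ 2) = K0 at *
  generalize k 2 * u (P 1 ^ 2) / u (P 2 ^ 2) = K1 at *
  generalize k 3 * u (P 2 ^ 2) / u (P 3 ^ 2) = K2 at *
  have hl0 : ∀ f, u (L f) = K0 * u (P 1 * f) := by
    intro f; rw [← hd0, hP0, one_mul]
  have hl1 : ∀ f, u (X * L f) = K1 * u (P 2 * f) + b * (K0 * u (P 1 * f)) := by
    intro f
    rw [← hd1, ← hl0, ← u_C, ← map_add, hP1]; congr 1; ring
  have hl2 : ∀ f, u (X ^ 2 * L f) = K2 * u (P 3 * f) - p2 * (K1 * u (P 2 * f)) +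
      (-(p2 * b) - r) * (K0 * u (P 1 * f)) := by
    intro f
    rw [← hd1, ← hl0, ← hd2, ← u_C, ← u_C, ← map_sub, ← map_add, hP1, hP2]; congr 1
    simp only [map_mul, map_sub, map_neg]; ring
  -- the cubic relation
  have hG : ∀ f, K0 * u (P 1 * (X * (X * f))) - 2 * a * (u (X * L (X * f))) + u (X ^ 2 * L f)
      + (a ^ 2 - 1) * (K0 * u (P 1 * f)) = 0 := by
    intro f
    have e1 : u (L (X * (X * f))) = a * u (X * L (X * f)) + al * u (T (X * f)) := by
      rw [hI1 (X * f), map_add, u_C, u_C]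
    have e2 : u (X * L (X * f)) = a * u (X ^ 2 * L f) + al * u (X * T f) := by
      rw [hI1 f, ← u_C, ← u_C, ← map_add]; congr 1; ring
    have e3 : u (T (X * f)) = a * u (X * T f) + g * (u (X ^ 2 * L f) - u (L f)) := by
      rw [hI2 f, ← u_C, ← map_sub, ← u_C, ← map_add]; congr 1; ring
    rw [hl0] at e1
    rw [hl0 f] at e3
    linear_combination e1 + al * e3 - a * e2 + (u (X ^ 2 * L f) - K0 * u (P 1 * f)) * hag
  have hG0 := reg_zero hmonic hdeg horth hreg
    (C K0 * P 1 * X ^ 2 - C (2 * a) * X * (C K1 * P 2 + C (b * K0) * P 1) +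
      (C K2 * P 3 - C (p2 * K1) * P 2 + C ((-(p2 * b) - r) * K0) * P 1)
      + C ((a ^ 2 - 1) * K0) * P 1) (by
    intro f
    rw [← hG f, hl1, hl2]
    simp only [← u_C, ← map_sub, ← map_add, mul_add, mul_sub]
    congr 1
    simp only [map_mul, map_sub, map_neg, map_add, map_one, map_pow]
    ring)
  have hG1 : C (K0 - 2 * a * K1 + K2) * X ^ 3 +
      C (-(K0 * b) - 2 * a * (K1 * p2 + b * K0) + K2 * p3 - p2 * K1) * X ^ 2 +
      C (-(2 * a) * (K1 * r - b * K0 * b) + K2 * r3 - p2 * K1 * p2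
        + (-(p2 * b) - r) * K0 + (a ^ 2 - 1) * K0) * X +
      C (K2 * s3 - p2 * K1 * r - b * ((-(p2 * b) - r) * K0 + (a ^ 2 - 1) * K0)) = (0 : ℂ[X]) := by
    rw [hP1, hP2, hP3] at hG0
    rw [← hG0]
    simp only [map_mul, map_sub, map_neg, map_add, map_one, map_pow, map_ofNat]
    ring
  obtain ⟨g3, g2, -, g0⟩ := cubic_zero hG1
  have hb : b = 0 := by
    have : b * ((a - 1) * (2 * a + 1) * K2) = 0 := by
      rw [hp2, hp3] at g2
      have hK2e : K2 = 2 * a * K1 - K0 := by linear_combination g3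
      rw [hK2e] at g2 ⊢
      linear_combination -g2 / 2
    rcases mul_eq_zero.1 this with h | h
    · exact h
    · exact absurd h (mul_ne_zero (mul_ne_zero ha1 ha2) hK2ne)
  subst hb
  have hp2' : p2 = 0 := by rw [hp2]; ring
  have hp3' : p3 = 0 := by rw [hp3]; ring
  subst hp2' hp3'
  have hs3 : s3 = 0 := by
    have : K2 * s3 = 0 := by linear_combination g0
    exact (mul_eq_zero.1 this).resolve_left hK2ne
  subst hs3
  simp only [map_zero, zero_mul, add_zero, sub_zero] at hP1 hP2 hP3
  have hk4 : p4 = 0 ∧ s4 = 0 ∧ r4 = (4 * a ^ 2 - 2) * r3 + 2 * (a ^ 2 - 1) := by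
    have h := hL 3
    norm_num only at h
    rw [hP3, hP4, map_add, map_add, map_add, map_add, hLC, hLC, hLC, hLX, hLc, hLX2, hLX3,
      hLX4] at h
    have h' : C (k 4 - (8 * a ^ 3 - 4 * a) * al) * X ^ 3 + C (- p4 * (4 * a ^ 2 - 1) * al) * X ^ 2
        + C (k 4 * r3 + 4 * a * (a ^ 2 - 1) * al - r4 * (2 * a * al)) * X
        + C (p4 * al * (a ^ 2 - 1) - s4 * al)
        = (0 : ℂ[X]) := by
      simp only [map_mul, map_ofNat, map_sub, map_add, map_pow, map_one, map_neg] at h ⊢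
      linear_combination -h
    obtain ⟨h0, h1, h2, h3⟩ := cubic_zero h'
    have hp4 : p4 = 0 := by
      have : p4 * ((4 * a ^ 2 - 1) * al) = 0 := by linear_combination -h1
      exact (mul_eq_zero.1 this).resolve_right (mul_ne_zero ha3 hal)
    refine ⟨hp4, ?_, ?_⟩
    · rw [hp4] at h3
      apply mul_left_cancel₀ hal
      linear_combination -h3
    · apply mul_left_cancel₀ (mul_ne_zero (mul_ne_zero two_ne_zero ha) hal)
      linear_combination -h2 + r3 * h0
  obtain ⟨hp4, hs4, hr4⟩ := hk4
  subst hp4 hs4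
  simp only [map_zero, zero_mul, add_zero] at hP4
  have q1 : u (P 1 ^ 2) = -r * u (P 0 ^ 2) := by
    have h := horth 2 0 (by norm_num)
    have : P 1 ^ 2 = P 2 * P 0 + C (-r) * P 0 ^ 2 := by
      rw [hP1, hP2, hP0, map_neg]; ring
    rw [this, map_add, h, u_C, zero_add]
  have q2 : u (P 2 ^ 2) = (r - r3) * u (P 1 ^ 2) := by
    have h := horth 2 0 (by norm_num)
    have h' := horth 3 1 (by norm_num)
    have : P 2 ^ 2 = P 3 * P 1 + C (r - r3) * P 1 ^ 2 + C r * (P 2 * P 0) := by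
      rw [hP1, hP2, hP3, hP0, map_sub]; ring
    rw [this, map_add, map_add, u_C, u_C, h, h']; ring
  have q3 : u (P 3 ^ 2) = (r3 - r4) * u (P 2 ^ 2) := by
    have h := horth 2 0 (by norm_num)
    have h' := horth 3 1 (by norm_num)
    have h'' := horth 4 2 (by norm_num)
    have : P 3 ^ 2 = P 4 * P 2 + C (r3 - r4) * P 2 ^ 2 + C (-(r3 - r4) * r - v4) * (P 2 * P 0)
        + C (r3 - r) * (P 3 * P 1) := by
      rw [hP1, hP2, hP3, hP4, hP0]
      simp only [map_mul, map_sub, map_neg]; ring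
    rw [this, map_add, map_add, map_add, u_C, u_C, u_C, h, h', h'']; ring
  have c1 : K0 * (-r) = al := by
    apply mul_right_cancel₀ hh0
    linear_combination hK0h - K0 * q1
  have c2 : K1 * (r - r3) = 2 * a * al := by
    apply mul_right_cancel₀ hh1
    linear_combination hK1h - K1 * q2
  have c3 : K2 * (r3 - r4) = (4 * a ^ 2 - 1) * al := by
    apply mul_right_cancel₀ hh2
    linear_combination hK2h - K2 * q3
  refine ⟨r, r3, K0, K1, K2, ?_, hr3, c1, c2, g3, ?_, ?_, ?_⟩
  · have e : al * ((r - r3) * (r3 - r4) - 4 * a ^ 2 * (-r) * (r3 - r4)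
        + (4 * a ^ 2 - 1) * (-r) * (r - r3)) = 0 := by
      linear_combination (-r) * (r - r3) * (r3 - r4) * g3 - (r - r3) * (r3 - r4) * c1
        + 2 * a * (-r) * (r3 - r4) * c2 - (-r) * (r - r3) * c3
    have e' := (mul_eq_zero.1 e).resolve_left hal
    apply mul_left_cancel₀ (mul_ne_zero (mul_ne_zero ha3 ha4) (by norm_num : (4 : ℂ) ≠ 0))
    rw [hr4, hr3] at e'
    linear_combination e'
  · intro f; rw [hl0, hP1]
  · intro f; rw [hl1, hP2]
    rw [zero_mul, add_zero, add_mul, map_add, u_C]; ring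
  · intro f; rw [hl2, hP3, hP1]
    rw [add_mul, map_add, mul_assoc, u_C]; ring

end opsq

theorem fin_alg (z al a r r3 K0 K1 K2 : ℂ) (hz : z ≠ 0) (h2 : 1 - z ^ 2 ≠ 0) (h2' : 1 + z ^ 2 ≠ 0)
    (h4 : 1 + z ^ 4 ≠ 0) (hal : al = (z + z⁻¹) / 2) (ha : a = 2 * al ^ 2 - 1)
    (hr : r = -(1 - z ^ 4) / 4) (hr3 : r3 = (4 * a ^ 2 - 1) * r + (a ^ 2 - 1))
    (c1 : K0 * (-r) = al) (c2 : K1 * (r - r3) = 2 * a * al) (c3 : K0 - 2 * a * K1 + K2 = 0)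
    (m0 m1 m2 m3 l0 l1 l2 ss xss dd sd : ℂ)
    (e0 : l0 = K0 * m1) (e1 : l1 = K1 * m2 + K1 * r * m0)
    (e2 : l2 = K2 * m3 + (K2 * r3 - r * K0) * m1)
    (i1 : K0 * m2 = a * l1 + al * (2 * ss - m0))
    (i1x : K1 * m3 + K1 * r * m1 = a * l2 + al * (2 * xss - m1))
    (i3 : 2 * (al ^ 2 - 1) * dd = al * (2 * ss - m0 - m0) - 2 * (al ^ 2 - 1) * l1)
    (i4 : 2 * sd = 2 * al * (l2 - l0) - (2 * xss - m1 - m1)) :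
    z * (z ^ 2 - 1) * (-l0) = 2 * m1 ∧
    4 * (al ^ 2 - 1) * z ^ 5 * dd = -4 * m2 + (1 - z ^ 4) * m0 ∧
    4 * z ^ 4 * ss = -4 * m2 + (1 + 3 * z ^ 4) * m0 ∧
    2 * z ^ 6 * (1 - z ^ 2) * (-sd) = -4 * m3 + (z ^ 8 + z ^ 4 + 2) * m1 := by
  have hal' : al = (z ^ 2 + 1) / (2 * z) := by rw [hal]; field_simp
  have ha' : a = (z ^ 4 + 1) / (2 * z ^ 2) := by rw [ha, hal']; field_simp; ring
  have haln : al ≠ 0 := by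
    rw [hal']
    exact div_ne_zero (by rw [add_comm]; exact h2') (mul_ne_zero two_ne_zero hz)
  have hrr : r - r3 = (1 - z ^ 2) * (1 + z ^ 2) * (1 + z ^ 4) / 4 := by
    rw [hr3, hr, ha']; field_simp; ring
  have hr3' : r3 = -(1 - z ^ 4) * (2 + z ^ 4) / 4 := by linear_combination hr - hrr
  have hK0 : K0 = 2 / (z * (1 - z ^ 2)) := by
    have : -r ≠ 0 := by
      have : -r = (1 - z ^ 2) * (1 + z ^ 2) / 4 := by rw [hr]; ring
      rw [this]; exact div_ne_zero (mul_ne_zero h2 h2') (by norm_num)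
    apply mul_right_cancel₀ this
    rw [c1, hr, hal']; field_simp; ring
  have hK1 : K1 = 2 / (z ^ 3 * (1 - z ^ 2)) := by
    have hne : r - r3 ≠ 0 := by
      rw [hrr]; exact div_ne_zero (mul_ne_zero (mul_ne_zero h2 h2') h4) (by norm_num)
    apply mul_right_cancel₀ hne
    rw [c2, hrr, hal', ha']; field_simp; ring
  have hK2 : K2 = 2 / (z ^ 5 * (1 - z ^ 2)) := by
    have : K2 = 2 * a * K1 - K0 := by linear_combination c3
    rw [this, hK0, hK1, ha']; field_simp; ring
  have e0' : l0 = 2 * m1 / (z * (1 - z ^ 2)) := by rw [e0, hK0]; field_simp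
  have e1' : l1 = 2 * (m2 - (1 - z ^ 4) / 4 * m0) / (z ^ 3 * (1 - z ^ 2)) := by
    rw [e1, hK1, hr]; field_simp; ring
  have e2' : l2 = 2 * m3 / (z ^ 5 * (1 - z ^ 2)) +
      (-(1 - z ^ 4) * (2 + z ^ 4) / (2 * z ^ 5 * (1 - z ^ 2))
        + (1 - z ^ 4) / (2 * z * (1 - z ^ 2))) * m1 := by
    rw [e2, hK2, hK0, hr3', hr]; field_simp; ring
  have ess : ss = (-4 * m2 + (1 + 3 * z ^ 4) * m0) / (4 * z ^ 4) := by
    have : al * (2 * ss - m0) = K0 * m2 - a * l1 := by linear_combination -i1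
    have h' : al * (2 * ss - m0) =
        al * (2 * ((-4 * m2 + (1 + 3 * z ^ 4) * m0) / (4 * z ^ 4)) - m0) := by
      rw [this, hK0, e1', hal', ha']; field_simp; ring
    have := mul_left_cancel₀ haln h'
    linear_combination this / 2
  have exss : 2 * xss - m1 = (K1 * m3 + K1 * r * m1 - a * l2) / al := by
    field_simp; linear_combination -i1x
  have edd : 2 * (al ^ 2 - 1) * dd = (-4 * m2 + (1 - z ^ 4) * m0) / (2 * z ^ 5) := by
    rw [i3, ess, e1', hal']; field_simp; ring
  refine ⟨?_, ?_, ?_, ?_⟩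
  · rw [e0']; field_simp; ring
  · have : 4 * (al ^ 2 - 1) * z ^ 5 * dd = 2 * z ^ 5 * (2 * (al ^ 2 - 1) * dd) := by ring
    rw [this, edd]; field_simp
  · rw [ess]; field_simp
  · have : 2 * z ^ 6 * (1 - z ^ 2) * (-sd) = -(z ^ 6 * (1 - z ^ 2) * (2 * sd)) := by ring
    have i4' : 2 * sd = 2 * al * (l2 - l0) - ((K1 * m3 + K1 * r * m1 - a * l2) / al - m1) := by
      rw [i4, ← exss]
    have h2'' : z ^ 2 + 1 ≠ 0 := by rw [add_comm]; exact h2'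
    rw [this, i4', e0', e2', hK1, hr, ha', hal']; field_simp; ring

/-- if the monic OPS of a regular functional `u` satisfies
`𝒟_q(𝒮_q P_n) = k_n P_{n-1}`, then there is `s = ±1` such that `u` satisfies the
four functional equations (stated here pointwise against every polynomial `f`). -/
theorem stmt_18 (q : ℝ) (hq0 : 0 < q) (hq1 : q < 1)
    (Dq Sq : ℂ[X] → ℂ[X]) (hD : IsAW q Dq) (hS : IsAv q Sq)
    (u : ℂ[X] →ₗ[ℂ] ℂ) (P : ℕ → ℂ[X])
    (hmonic : ∀ n, (P n).Monic) (hdeg : ∀ n, (P n).natDegree = n)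
    (horth : ∀ m n : ℕ, m ≠ n → u (P m * P n) = 0)
    (hreg : ∀ n : ℕ, u (P n ^ 2) ≠ 0)
    (k : ℕ → ℂ) (hAp : AppellDS Dq Sq P k) :
    ∃ s : ℤ, (s = 1 ∨ s = -1) ∧
      (∀ f : ℂ[X],
        (qh q) ^ s * ((q : ℂ) ^ s - 1) * (-(u (Dq (Sq f)))) = 2 * u (X * f)) ∧
      (∀ f : ℂ[X],
        4 * ((alp q) ^ 2 - 1) * (qh q) ^ (5 * s) *
          u ((X ^ 2 - Polynomial.C ((alp q) ^ 2)) * Dq (Dq f)) =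
        u ((-(4 : ℂ[X]) * X ^ 2 + Polynomial.C (1 - (q : ℂ) ^ (2 * s))) * f)) ∧
      (∀ f : ℂ[X],
        4 * (q : ℂ) ^ (2 * s) * u (Sq (Sq f)) =
          u ((-(4 : ℂ[X]) * X ^ 2 + Polynomial.C (1 + 3 * (q : ℂ) ^ (2 * s))) * f)) ∧
      (∀ f : ℂ[X],
        2 * (q : ℂ) ^ (3 * s) * (1 - (q : ℂ) ^ s) *
          (-(u ((X ^ 2 - Polynomial.C ((alp q) ^ 2)) * Sq (Dq f)))) =
        u ((X * (-(4 : ℂ[X]) * X ^ 2 +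
          Polynomial.C ((q : ℂ) ^ (4 * s) + (q : ℂ) ^ (2 * s) + 2))) * f)) := by
  have hqpos : 0 < Real.sqrt q := Real.sqrt_pos.2 hq0
  have hqlt : Real.sqrt q < 1 := by rw [Real.sqrt_lt' one_pos]; simpa using hq1
  have hqq : (qh q) ^ 2 = (q : ℂ) := by
    unfold qh; rw [← Complex.ofReal_pow, Real.sq_sqrt hq0.le]
  have ht : qh q ≠ 0 := by
    unfold qh; exact_mod_cast hqpos.ne'
  have hqne : (q : ℂ) ≠ 0 := by exact_mod_cast hq0.ne'
  have hq : (qh q) ^ 2 - 1 ≠ 0 := by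
    rw [hqq, sub_ne_zero]; exact_mod_cast hq1.ne
  -- real versions of the constants
  obtain ⟨A, hA, hA1⟩ : ∃ A : ℝ, aa q = (A : ℂ) ∧ 1 < A := by
    refine ⟨(q + q⁻¹) / 2, ?_, ?_⟩
    · unfold aa alp
      push_cast
      rw [← hqq]
      field_simp
      ring
    · have : 0 < (1 - q) ^ 2 / q := by
        apply div_pos _ hq0
        have : 0 < 1 - q := by linarith
        positivity
      have h2 : (1 - q) ^ 2 / q = q + q⁻¹ - 2 := by field_simp; ring
      linarith
  have halne : alp q ≠ 0 := by
    have : alp q = (((Real.sqrt q + (Real.sqrt q)⁻¹) / 2 : ℝ) : ℂ) := by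
      unfold alp qh; push_cast; rfl
    rw [this]
    exact_mod_cast (by positivity : (Real.sqrt q + (Real.sqrt q)⁻¹) / 2 ≠ 0)
  let L : ℂ[X] →ₗ[ℂ] ℂ[X] :=
    { toFun := fun f => Dq (Sq f)
      map_add' := L_add ht hq hD hS
      map_smul' := by
        intro c f
        simp only [RingHom.id_apply, smul_eq_C_mul]
        exact L_smul ht hq hD hS c f }
  have hLf : ∀ f, L f = Dq (Sq f) := fun f => rfl
  obtain ⟨r, r3, K0, K1, K2, hquad, hr3, c1, c2, c3, hl0, hl1, hl2⟩ :=
    core (u := u) hmonic hdeg horth hreg L (fun f => C 2 * Sq (Sq f) - f) k hAp.1 hAp.2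
      (alp q) (aa q) (4 * (alp q ^ 2 - 1) * alp q) (SS_one ht hS)
      (id1 ht hq hD hS) (id2 ht hq hD hS) (by unfold aa; ring) halne
      (by rw [hA]; exact_mod_cast (by linarith : (0 : ℝ) < A).ne')
      (by rw [hA]; exact_mod_cast (by linarith : 0 < A - 1).ne')
      (by rw [hA]; exact_mod_cast (by linarith : 0 < 2 * A + 1).ne')
      (by rw [hA]; exact_mod_cast (by nlinarith : 0 < 4 * A ^ 2 - 1).ne')
      (by rw [hA]; exact_mod_cast (by nlinarith : 1 - A ^ 2 < 0).ne)
  have hX : ∀ f, u (X * Dq (Sq (X * f))) = K1 * u (X ^ 3 * f) + K1 * r * u (X * f) := by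
    intro f
    rw [← hLf, hl1]
    congr 3
    ring
  have hfin : ∀ z : ℂ, z ≠ 0 → 1 - z ^ 2 ≠ 0 → 1 + z ^ 2 ≠ 0 → 1 + z ^ 4 ≠ 0 →
      alp q = (z + z⁻¹) / 2 → r = -(1 - z ^ 4) / 4 → ∀ f : ℂ[X],
      z * (z ^ 2 - 1) * (-(u (Dq (Sq f)))) = 2 * u (X * f) ∧
      4 * (alp q ^ 2 - 1) * z ^ 5 * u ((X ^ 2 - C (alp q ^ 2)) * Dq (Dq f)) =
        -4 * u (X ^ 2 * f) + (1 - z ^ 4) * u f ∧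
      4 * z ^ 4 * u (Sq (Sq f)) = -4 * u (X ^ 2 * f) + (1 + 3 * z ^ 4) * u f ∧
      2 * z ^ 6 * (1 - z ^ 2) * (-(u ((X ^ 2 - C (alp q ^ 2)) * Sq (Dq f)))) =
        -4 * u (X ^ 3 * f) + (z ^ 8 + z ^ 4 + 2) * u (X * f) := by
    intro z hz h2 h2' h4 hal hr f
    refine fin_alg z (alp q) (aa q) r r3 K0 K1 K2 hz h2 h2' h4 hal rfl hr hr3 c1 c2 c3
      (u f) (u (X * f)) (u (X ^ 2 * f)) (u (X ^ 3 * f)) (u (Dq (Sq f))) (u (X * Dq (Sq f)))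
      (u (X ^ 2 * Dq (Sq f))) (u (Sq (Sq f))) (u (X * Sq (Sq f))) _ _ (hl0 f) (hl1 f) (hl2 f)
      ?_ ?_ ?_ ?_
    · have h := hl0 (X * f)
      rw [hLf, id1 ht hq hD hS, map_add, u_C, u_C, map_sub, u_C, ← mul_assoc X X, ← pow_two] at h
      exact h.symm
    · have h := hX f
      rw [id1 ht hq hD hS] at h
      rw [← h]
      simp only [← u_C, ← map_sub, ← map_add]
      congr 1
      ring
    · rw [← u_C, id3 ht hq hD hS]
      simp only [map_sub, u_C]
    · rw [← u_C, id4 ht hq hD hS]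
      simp only [← u_C, ← map_sub, ← map_add]
      congr 1
      simp only [map_mul]
      ring
  have hconv : ∀ s : ℤ, (q : ℂ) ^ s = ((qh q) ^ s) ^ 2 := by
    intro s
    rw [← hqq, ← zpow_natCast, ← zpow_natCast, ← zpow_mul, ← zpow_mul, mul_comm]
  have hpw : ∀ (x : ℂ) (n : ℕ) (s : ℤ), x ^ ((n : ℤ) * s) = (x ^ s) ^ n := by
    intro x n s
    rw [mul_comm, zpow_mul, zpow_natCast]
  obtain ⟨s, hs, hr⟩ : ∃ s : ℤ, (s = 1 ∨ s = -1) ∧ r = -(1 - ((qh q) ^ s) ^ 4) / 4 := by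
    have hfac : (r + (1 - (qh q) ^ 4) / 4) * (r + (1 - ((qh q)⁻¹) ^ 4) / 4) = 0 := by
      rw [← hquad]
      unfold aa alp
      field_simp
      ring
    rcases mul_eq_zero.1 hfac with h | h
    · exact ⟨1, Or.inl rfl, by rw [zpow_one]; linear_combination h⟩
    · exact ⟨-1, Or.inr rfl, by rw [zpow_neg_one]; linear_combination h⟩
  have hal : alp q = ((qh q) ^ s + ((qh q) ^ s)⁻¹) / 2 := by
    rcases hs with rfl | rfl
    · rw [zpow_one]; rfl
    · rw [zpow_neg_one, inv_inv, add_comm]; rfl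
  have hzr : (qh q) ^ s = ((Real.sqrt q ^ s : ℝ) : ℂ) := by
    unfold qh; push_cast; rfl
  have hZ : 0 < Real.sqrt q ^ s := zpow_pos hqpos s
  have h12 : 1 - ((qh q) ^ s) ^ 2 ≠ 0 := by
    rcases hs with rfl | rfl
    · rw [zpow_one]; intro h; apply hq; linear_combination -h
    · rw [zpow_neg_one]; intro h; apply hq; field_simp at h; linear_combination h
  have h22 : 1 + ((qh q) ^ s) ^ 2 ≠ 0 := by
    rw [hzr]
    exact_mod_cast (by positivity : 1 + (Real.sqrt q ^ s) ^ 2 ≠ 0)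
  have h44 : 1 + ((qh q) ^ s) ^ 4 ≠ 0 := by
    rw [hzr]
    exact_mod_cast (by positivity : 1 + (Real.sqrt q ^ s) ^ 4 ≠ 0)
  have hF := hfin _ (zpow_ne_zero s ht) h12 h22 h44 hal hr
  have w5 : (qh q) ^ (5 * s) = ((qh q) ^ s) ^ 5 := hpw _ 5 s
  have w2 : (q : ℂ) ^ (2 * s) = ((qh q) ^ s) ^ 4 := by
    have := hpw (q : ℂ) 2 s
    rw [hconv s, ← pow_mul] at this; exact this
  have w3 : (q : ℂ) ^ (3 * s) = ((qh q) ^ s) ^ 6 := by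
    have := hpw (q : ℂ) 3 s
    rw [hconv s, ← pow_mul] at this; exact this
  have w4 : (q : ℂ) ^ (4 * s) = ((qh q) ^ s) ^ 8 := by
    have := hpw (q : ℂ) 4 s
    rw [hconv s, ← pow_mul] at this; exact this
  have hC4 : (4 : ℂ[X]) = C 4 := (map_ofNat C 4).symm
  refine ⟨s, hs, ?_⟩
  rw [w5, w2, w3, w4, hconv s, hC4]
  generalize (qh q) ^ s = z at *
  refine ⟨fun f => (hF f).1, fun f => ?_, fun f => ?_, fun f => ?_⟩
  · rw [(hF f).2.1]
    simp only [← u_C, ← map_add]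
    congr 1; simp only [map_neg]; ring
  · rw [(hF f).2.2.1]
    simp only [← u_C, ← map_add]
    congr 1; simp only [map_neg]; ring
  · rw [(hF f).2.2.2]
    simp only [← u_C, ← map_add]
    congr 1; simp only [map_neg]; ring
end

section
/- Let u be a regular linear functional on ℂ[z] with monic OPS (P_n)_{n≥0}, and suppose that for some s ∈ {1, −1} the functional u satisfies the four equations: q^{s/2}(q^s − 1)·𝐒_q(𝐃_q u) = 2·(z·u); 4(α² − 1)q^{5s/2}·𝐃_q(𝐃_q((z² − α²)·u)) = (−4z² + 1 − q^{2s})·u; 4q^{2s}·𝐒_q(𝐒_q u) = (−4z² + 1 + 3q^{2s})·u; and 2q^{3s}(1 − q^s)·𝐃_q(𝐒_q((z² − α²)·u)) = (z·(−4z² + q^{4s} + q^{2s} + 2))·u. Then the recurrence coefficients of (P_n) are B_n = 0 and C_{n+1} = (1/4)(1 − q^{2s(n+1)}) for all n ≥ 0, i.e. P_n is the Rogers q^{2s}-Hermite polynomial Q_n(z; s q^{s/2}, −s q^{s/2} | q^s), and 𝒟_q(𝒮_q P_n) = (γ_{2n}/2)·P_{n−1} for all n ≥ 1. -/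
open Polynomial

/-- The coefficients `(1 - t^{2n})/4`. -/
noncomputable def cc19 (t : ℂ) (n : ℕ) : ℂ := (1 - t ^ (2 * n)) / 4

/-- Monic Rogers `t²`-Hermite polynomials. -/
noncomputable def RH19 (t : ℂ) : ℕ → ℂ[X]
  | 0 => 1
  | 1 => X
  | (n + 2) => X * RH19 t (n + 1) - Polynomial.C (cc19 t (n + 1)) * RH19 t n

theorem RH19_shift (t w : ℂ) (ht : t ≠ 0) (hw : w ≠ 0) (n : ℕ) :
    t ^ (n + 1) * (RH19 t (n + 1)).eval ((t * w + t⁻¹ * w⁻¹) / 2) =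
      (RH19 t (n + 1)).eval ((w + w⁻¹) / 2) -
        2 * cc19 t (n + 1) * w * (RH19 t n).eval ((w + w⁻¹) / 2) := by
  induction n using Nat.twoStepInduction with
  | zero =>
    simp [RH19, cc19]
    field_simp
    ring
  | one =>
    simp [RH19, cc19]
    field_simp
    ring
  | more n ih1 ih2 =>
    have e : ∀ z, (RH19 t (n + 3)).eval z =
        z * (RH19 t (n + 2)).eval z - cc19 t (n + 2) * (RH19 t (n + 1)).eval z := by
      intro z; simp [RH19]
    have e2 : ∀ z, (RH19 t (n + 2)).eval z =
        z * (RH19 t (n + 1)).eval z - cc19 t (n + 1) * (RH19 t n).eval z := by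
      intro z; simp [RH19]
    have key : t ^ (n + 3) * (RH19 t (n + 3)).eval ((t * w + t⁻¹ * w⁻¹) / 2) =
        t * ((t * w + t⁻¹ * w⁻¹) / 2) *
          (t ^ (n + 2) * (RH19 t (n + 2)).eval ((t * w + t⁻¹ * w⁻¹) / 2)) -
        cc19 t (n + 2) * t ^ 2 *
          (t ^ (n + 1) * (RH19 t (n + 1)).eval ((t * w + t⁻¹ * w⁻¹) / 2)) := by
      rw [e]; ring
    change t ^ (n + 3) * (RH19 t (n + 3)).eval _ = (RH19 t (n + 3)).eval _ -
      2 * cc19 t (n + 3) * w * (RH19 t (n + 2)).eval _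
    have ih2' : t ^ (n + 2) * (RH19 t (n + 2)).eval ((t * w + t⁻¹ * w⁻¹) / 2) =
      (RH19 t (n + 2)).eval ((w + w⁻¹) / 2) -
        2 * cc19 t (n + 2) * w * (RH19 t (n + 1)).eval ((w + w⁻¹) / 2) := ih2
    rw [key, ih2', ih1, e, e2]
    generalize (RH19 t (n + 1)).eval ((w + w⁻¹) / 2) = a
    generalize (RH19 t n).eval ((w + w⁻¹) / 2) = b
    have h1 : cc19 t (n + 1) = (1 - t ^ (2 * n) * t ^ 2) / 4 := by simp only [cc19]; ring
    have h2 : cc19 t (n + 2) = (1 - t ^ (2 * n) * t ^ 4) / 4 := by simp only [cc19]; ring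
    have h3 : cc19 t (n + 3) = (1 - t ^ (2 * n) * t ^ 6) / 4 := by simp only [cc19]; ring
    rw [h1, h2, h3]
    generalize t ^ (2 * n) = T
    field_simp
    ring

theorem RH19_diff (t w : ℂ) (ht : t ≠ 0) (hw : w ≠ 0) (n : ℕ) :
    (RH19 t (n + 1)).eval ((t * w + t⁻¹ * w⁻¹) / 2) -
      (RH19 t (n + 1)).eval ((t⁻¹ * w + t * w⁻¹) / 2) =
      (t ^ (n + 1) - (t ^ (n + 1))⁻¹) / 2 * (w - w⁻¹) * (RH19 t n).eval ((w + w⁻¹) / 2) := by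
  have h1 := RH19_shift t w ht hw n
  have h2 := RH19_shift t w⁻¹ ht (inv_ne_zero hw) n
  rw [inv_inv, add_comm (t * w⁻¹), add_comm w⁻¹ w] at h2
  have hp : t ^ (n + 1) ≠ 0 := pow_ne_zero _ ht
  apply mul_left_cancel₀ hp
  rw [mul_sub, h1, h2]
  have h3 : cc19 t (n + 1) = (1 - t ^ (n + 1) * t ^ (n + 1)) / 4 := by simp only [cc19]; ring
  rw [h3]
  generalize t ^ (n + 1) = T at *
  field_simp
  ring

theorem RH19_monic (t : ℂ) (n : ℕ) : (RH19 t n).Monic ∧ (RH19 t n).natDegree = n := by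
  induction n using Nat.twoStepInduction with
  | zero => simp [RH19]
  | one => simp [RH19, monic_X]
  | more n ih1 ih2 =>
    have hm : (X * RH19 t (n + 1)).Monic := monic_X.mul ih2.1
    have hd : (X * RH19 t (n + 1)).natDegree = n + 2 := by
      rw [monic_X.natDegree_mul ih2.1, ih2.2, natDegree_X]; ring
    have hlt : (Polynomial.C (cc19 t (n + 1)) * RH19 t n).degree < (X * RH19 t (n + 1)).degree := by
      rw [degree_eq_natDegree hm.ne_zero, hd]
      refine lt_of_le_of_lt (degree_mul_le _ _) ?_
      refine lt_of_le_of_lt (add_le_add_left degree_C_le _) ?_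
      rw [zero_add, degree_eq_natDegree ih1.1.ne_zero, ih1.2]
      exact_mod_cast (by omega : n < n + 2)
    simp only [RH19]
    refine ⟨hm.sub_of_left hlt, ?_⟩
    rw [natDegree_eq_of_degree_eq (degree_sub_eq_left_of_degree_lt hlt), hd]

theorem natDeg19 (f : ℂ[X]) (n : ℕ) (hn : n ≠ 0) (hf : f.degree < n) : f.natDegree < n := by
  by_cases h : f = 0
  · rw [h, natDegree_zero]; omega
  · exact (natDegree_lt_iff_degree_lt h).2 hf

theorem orth19 (u : ℂ[X] →ₗ[ℂ] ℂ) (p : ℂ[X]) (n : ℕ)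
    (h : ∀ k < n, u (X ^ k * p) = 0) (f : ℂ[X]) (hf : f.degree < n) : u (f * p) = 0 := by
  rcases Nat.eq_zero_or_pos n with rfl | hn
  · have : f = 0 := by
      by_contra h0
      rw [degree_eq_natDegree h0] at hf
      exact absurd hf (by simp)
    simp [this]
  have hf' : f.natDegree < n := natDeg19 f n hn.ne' hf
  rw [f.as_sum_range' n hf', Finset.sum_mul, map_sum]
  refine Finset.sum_eq_zero fun k hk => ?_
  rw [← C_mul_X_pow_eq_monomial, mul_assoc, ← smul_eq_C_mul, map_smul, h k (Finset.mem_range.1 hk),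
    smul_zero]

theorem qh_facts (q : ℝ) (hq0 : 0 < q) (hq1 : q < 1) :
    qh q ≠ 0 ∧ qh q * qh q = (q : ℂ) ∧ qh q - (qh q)⁻¹ ≠ 0 := by
  have h0 : qh q ≠ 0 := by
    simp only [qh, ne_eq, Complex.ofReal_eq_zero]
    exact (Real.sqrt_pos.2 hq0).ne'
  have h1 : qh q * qh q = (q : ℂ) := by
    simp only [qh, ← Complex.ofReal_mul, Real.mul_self_sqrt hq0.le]
  refine ⟨h0, h1, fun h => ?_⟩
  have : qh q * qh q = 1 := by
    rw [sub_eq_zero] at h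
    nth_rewrite 2 [h]
    exact mul_inv_cancel₀ h0
  rw [h1] at this
  have : q = 1 := by exact_mod_cast this
  linarith

theorem DS19 (q : ℝ) (hq0 : 0 < q) (hq1 : q < 1)
    (Dq Sq : ℂ[X] → ℂ[X]) (hD : IsAW q Dq) (hS : IsAv q Sq) (f r : ℂ[X])
    (h : ∀ w : ℂ, w ≠ 0 → f.eval (((q : ℂ) * w + (q : ℂ)⁻¹ * w⁻¹) / 2) -
      f.eval (((q : ℂ)⁻¹ * w + (q : ℂ) * w⁻¹) / 2) =
      (qh q - (qh q)⁻¹) * (w - w⁻¹) * r.eval ((w + w⁻¹) / 2)) :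
    Dq (Sq f) = r := by
  obtain ⟨h0, h1, h2⟩ := qh_facts q hq0 hq1
  rw [← h1] at h
  set a := qh q with ha
  have hne : ((X ^ 2 - 1) * (X ^ 2 - Polynomial.C (((a + a⁻¹) / 2) ^ 2)) : ℂ[X]) ≠ 0 := by
    apply mul_ne_zero
    · exact (monic_X_pow_sub_C (1 : ℂ) (by norm_num : (2 : ℕ) ≠ 0)).ne_zero
    · exact (monic_X_pow_sub_C (((a + a⁻¹) / 2) ^ 2) (by norm_num : (2 : ℕ) ≠ 0)).ne_zero
  apply mul_left_cancel₀ hne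
  apply Polynomial.funext
  intro z
  simp only [eval_mul, eval_sub, eval_pow, eval_X, eval_one, eval_C]
  by_cases hz1 : z ^ 2 = 1
  · rw [hz1]; ring
  by_cases hz2 : z ^ 2 = ((a + a⁻¹) / 2) ^ 2
  · rw [hz2]; ring
  congr 1
  obtain ⟨y, hy⟩ := IsAlgClosed.exists_pow_nat_eq (z ^ 2 - 1) (by norm_num : 0 < 2)
  have hw0 : z + y ≠ 0 := by
    intro h'
    have : y = -z := by linear_combination h'
    rw [this] at hy
    have : (1 : ℂ) = 0 := by linear_combination hy
    exact one_ne_zero this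
  obtain ⟨w, hw⟩ : ∃ w, w = z + y := ⟨_, rfl⟩
  rw [← hw] at hw0
  have hwi : w⁻¹ = z - y := by
    rw [inv_eq_iff_eq_inv]
    refine eq_inv_of_mul_eq_one_left ?_
    rw [hw]; linear_combination -hy
  have hz : z = (w + w⁻¹) / 2 := by rw [hwi, hw]; ring
  rw [hz] at hz1 hz2 ⊢
  have w1 : w ^ 2 ≠ 1 := by
    intro h'
    apply hz1
    have : w⁻¹ ^ 2 = 1 := by rw [inv_pow, h', inv_one]
    have h3 : w * w⁻¹ = 1 := mul_inv_cancel₀ hw0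
    linear_combination (1 / 4) * h' + (1 / 4) * this + (1 / 2) * h3
  have aux : ∀ v : ℂ, v ^ 2 = a ^ 2 ∨ v ^ 2 = (a⁻¹) ^ 2 → v ≠ 0 →
      ((v + v⁻¹) / 2) ^ 2 = ((a + a⁻¹) / 2) ^ 2 := by
    intro v hv hv0
    have h3 : v * v⁻¹ = 1 := mul_inv_cancel₀ hv0
    have h4 : a * a⁻¹ = 1 := mul_inv_cancel₀ h0
    rcases hv with hv | hv
    · have : v⁻¹ ^ 2 = a⁻¹ ^ 2 := by rw [inv_pow, hv, inv_pow]
      linear_combination (1 / 4) * hv + (1 / 4) * this + (1 / 2) * h3 - (1 / 2) * h4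
    · have : v⁻¹ ^ 2 = a ^ 2 := by rw [inv_pow, hv, inv_pow, inv_inv]
      linear_combination (1 / 4) * hv + (1 / 4) * this + (1 / 2) * h3 - (1 / 2) * h4
  have w2 : (a * w) ^ 2 ≠ 1 := by
    intro h'
    refine hz2 (aux w (Or.inr ?_) hw0)
    rw [inv_pow]
    refine eq_inv_of_mul_eq_one_left ?_
    linear_combination h'
  have w3 : (a⁻¹ * w) ^ 2 ≠ 1 := by
    intro h'
    refine hz2 (aux w (Or.inl ?_) hw0)
    field_simp at h'
    exact h'
  have e1 := hS f (a * w) (mul_ne_zero h0 hw0) w2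
  have e2 := hS f (a⁻¹ * w) (mul_ne_zero (inv_ne_zero h0) hw0) w3
  rw [← ha] at e1 e2
  simp only [mul_inv, inv_inv, ← mul_assoc, mul_inv_cancel₀ h0, inv_mul_cancel₀ h0, one_mul]
    at e1 e2
  have e3 := hD (Sq f) w hw0 w1
  rw [← ha, e1, e2] at e3
  have e4 := h w hw0
  simp only [mul_inv] at e4
  have hww : w - w⁻¹ ≠ 0 := by
    intro h'
    apply w1
    have h3 : w * w⁻¹ = 1 := mul_inv_cancel₀ hw0
    linear_combination w * h' + h3
  rw [e3, div_eq_iff (mul_ne_zero (div_ne_zero h2 two_ne_zero) hww)]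
  linear_combination (1 / 2) * e4

/-- if a regular functional `u` with monic OPS `(P_n)` satisfies the four
functional equations (for some `s = ±1`), then `B_n = 0`,
`C_{n+1} = (1/4)(1 − q^{2s(n+1)})`, i.e. `P_n = Q_n(z; s q^{s/2}, −s q^{s/2} | q^s)`,
and `𝒟_q(𝒮_q P_n) = (γ_{2n}/2)·P_{n−1}` for all `n ≥ 1`. -/
theorem stmt_19 (q : ℝ) (hq0 : 0 < q) (hq1 : q < 1)
    (Dq Sq : ℂ[X] → ℂ[X]) (hD : IsAW q Dq) (hS : IsAv q Sq)
    (u : ℂ[X] →ₗ[ℂ] ℂ) (P : ℕ → ℂ[X]) (B Co : ℕ → ℂ)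
    (hops : MonicOPS P B Co)
    (horth : ∀ m n : ℕ, m ≠ n → u (P m * P n) = 0)
    (hreg : ∀ n : ℕ, u (P n ^ 2) ≠ 0)
    (s : ℤ) (hs : s = 1 ∨ s = -1)
    (heq1 : ∀ f : ℂ[X],
      (qh q) ^ s * ((q : ℂ) ^ s - 1) * (-(u (Dq (Sq f)))) = 2 * u (X * f))
    (heq2 : ∀ f : ℂ[X],
      4 * ((alp q) ^ 2 - 1) * (qh q) ^ (5 * s) *
        u ((X ^ 2 - Polynomial.C ((alp q) ^ 2)) * Dq (Dq f)) =
      u ((-(4 : ℂ[X]) * X ^ 2 + Polynomial.C (1 - (q : ℂ) ^ (2 * s))) * f))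
    (heq3 : ∀ f : ℂ[X],
      4 * (q : ℂ) ^ (2 * s) * u (Sq (Sq f)) =
        u ((-(4 : ℂ[X]) * X ^ 2 + Polynomial.C (1 + 3 * (q : ℂ) ^ (2 * s))) * f))
    (heq4 : ∀ f : ℂ[X],
      2 * (q : ℂ) ^ (3 * s) * (1 - (q : ℂ) ^ s) *
        (-(u ((X ^ 2 - Polynomial.C ((alp q) ^ 2)) * Sq (Dq f)))) =
      u ((X * (-(4 : ℂ[X]) * X ^ 2 +
        Polynomial.C ((q : ℂ) ^ (4 * s) + (q : ℂ) ^ (2 * s) + 2))) * f)) :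
    (∀ n : ℕ, B n = 0) ∧
    (∀ n : ℕ, Co (n + 1) = (1 - (q : ℂ) ^ (2 * s * ((n : ℤ) + 1))) / 4) ∧
    (∀ n : ℕ, Dq (Sq (P (n + 1))) =
      Polynomial.C (gamn q (2 * ((n : ℤ) + 1)) / 2) * P n) := by
  obtain ⟨h0, h1, h2⟩ := qh_facts q hq0 hq1
  have hqc : (q : ℂ) ≠ 0 := by exact_mod_cast hq0.ne'
  obtain ⟨t, ht⟩ : ∃ t : ℂ, t = (q : ℂ) ^ s := ⟨_, rfl⟩
  have ht0 : t ≠ 0 := by rw [ht]; exact zpow_ne_zero _ hqc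
  -- Appell property
  have hA : ∀ n : ℕ, Dq (Sq (RH19 t (n + 1))) =
      Polynomial.C (gamn q (2 * ((n : ℤ) + 1)) / 2) * RH19 t n := by
    intro n
    refine DS19 q hq0 hq1 Dq Sq hD hS _ _ fun w hw => ?_
    have hg : (qh q - (qh q)⁻¹) * gamn q (2 * ((n : ℤ) + 1)) =
        (q : ℂ) ^ (n + 1) - ((q : ℂ) ^ (n + 1))⁻¹ := by
      rw [gamn, mul_div_cancel₀ _ h2, zpow_neg, zpow_mul]
      have : (qh q) ^ (2 : ℤ) = (q : ℂ) := by rw [← h1]; exact zpow_two _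
      rw [this]
      norm_cast
    rw [eval_mul, eval_C]
    have hd := RH19_diff t w ht0 hw n
    rcases hs with rfl | rfl
    · rw [zpow_one] at ht
      rw [ht] at hd ⊢
      rw [hd]
      linear_combination (-(w - w⁻¹) * (RH19 (q : ℂ) n).eval ((w + w⁻¹) / 2) / 2) * hg
    · rw [zpow_neg_one] at ht
      rw [ht] at hd ⊢
      rw [inv_inv, inv_pow, inv_inv] at hd
      linear_combination (-(w - w⁻¹) * (RH19 (q : ℂ)⁻¹ n).eval ((w + w⁻¹) / 2) / 2) * hg - hd
  have hA0 : Dq (Sq (RH19 t 0)) = 0 := by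
    refine DS19 q hq0 hq1 Dq Sq hD hS _ _ fun w hw => ?_
    simp [RH19]
  have hX : ∀ n, X * RH19 t (n + 1) =
      RH19 t (n + 2) + cc19 t (n + 1) • RH19 t n := by
    intro n; rw [smul_eq_C_mul]; simp only [RH19]; ring
  have hX0 : X * RH19 t 0 = RH19 t 1 := by simp [RH19]
  have hc1 : (qh q) ^ s * ((q : ℂ) ^ s - 1) * (-(gamn q 2 / 2)) = 2 * cc19 t 1 := by
    have hg : gamn q 2 = qh q + (qh q)⁻¹ := by
      rw [gamn, div_eq_iff h2, zpow_neg]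
      have : (qh q) ^ (2 : ℤ) = qh q * qh q := zpow_two _
      rw [this]
      field_simp
      ring
    rw [hg, cc19, ht, ← h1]
    rcases hs with rfl | rfl
    · simp only [zpow_one]; field_simp; ring
    · simp only [zpow_neg_one, mul_inv]
      have h4 : qh q * (qh q)⁻¹ = 1 := mul_inv_cancel₀ h0
      generalize (qh q)⁻¹ = b at *
      linear_combination (-(b * b - 1) / 2) * h4
  have hu : ∀ n, u (RH19 t (n + 1)) = 0 := by
    intro n
    induction n using Nat.twoStepInduction with
    | zero =>
      have := heq1 (RH19 t 0)
      rw [hA0, hX0, map_zero] at this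
      simpa using this.symm
    | one =>
      have := heq1 (RH19 t 1)
      rw [hA 0, hX 0, map_add, map_smul, ← smul_eq_C_mul, map_smul] at this
      simp only [Nat.cast_zero, zero_add, mul_one, smul_eq_mul] at this
      change u (RH19 t 2) = 0
      linear_combination (-1 / 2) * this + (1 / 2) * u (RH19 t 0) * hc1
    | more n ih1 ih2 =>
      have := heq1 (RH19 t (n + 2))
      rw [hA (n + 1), hX (n + 1), map_add, map_smul, ← smul_eq_C_mul, map_smul, ih1] at this
      simpa using this.symm
  have hRo : ∀ k n, k < n → u (X ^ k * RH19 t n) = 0 := by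
    intro k
    induction k with
    | zero =>
      rintro (_ | n) hn
      · omega
      · simpa using hu n
    | succ k ih =>
      rintro (_ | n) hn
      · omega
      · rw [pow_succ, mul_assoc, hX, mul_add, mul_smul_comm, map_add, map_smul, ih _ (by omega),
          ih _ (by omega)]
        simp
  -- orthogonality of P with lower degree
  have hPo : ∀ m f, f.degree < ((m : ℕ) : WithBot ℕ) → ∀ n, m ≤ n → u (f * P n) = 0 := by
    intro m
    induction m with
    | zero =>
      intro f hf n _
      have : f = 0 := by
        by_contra h'
        rw [degree_eq_natDegree h'] at hf
        exact absurd hf (by simp)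
      simp [this]
    | succ m ih =>
      intro f hf n hn
      have hfm : f.natDegree ≤ m := by
        have := natDeg19 f (m + 1) (Nat.succ_ne_zero m) hf
        omega
      have hlow : (f - Polynomial.C (f.coeff m) * P m).degree < (m : WithBot ℕ) := by
        rw [degree_lt_iff_coeff_zero]
        intro j hj
        have hPm : (P m).coeff m = 1 := by
          have := (hops.monic m).coeff_natDegree
          rwa [hops.deg m] at this
        rcases hj.eq_or_lt with rfl | hj
        · simp [hPm]
        · rw [coeff_sub, coeff_C_mul, coeff_eq_zero_of_natDegree_lt (p := f) (by omega),
            coeff_eq_zero_of_natDegree_lt (p := P m) (by rw [hops.deg]; exact hj)]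
          simp
      have := ih _ hlow n (by omega)
      rw [sub_mul, map_sub, mul_assoc, ← smul_eq_C_mul, map_smul, horth m n (by omega)] at this
      simpa using this
  have hPR : ∀ n, P n = RH19 t n := by
    intro n
    by_contra hne
    have hd0 : P n - RH19 t n ≠ 0 := sub_ne_zero.2 hne
    obtain ⟨rm, rd⟩ := RH19_monic t n
    obtain ⟨d, hd⟩ : ∃ d, d = P n - RH19 t n := ⟨_, rfl⟩
    rw [← hd] at hd0
    have hdlt : d.degree < (n : WithBot ℕ) := by
      rw [hd]
      have hPn : (P n).degree = n := by
        rw [degree_eq_natDegree (hops.monic n).ne_zero, hops.deg]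
      have hRn : (RH19 t n).degree = n := by rw [degree_eq_natDegree rm.ne_zero, rd]
      rw [← hPn]
      exact degree_sub_lt_left (by rw [hPn, hRn]) (hops.monic n).ne_zero
        (by rw [(hops.monic n).leadingCoeff, rm.leadingCoeff])
    obtain ⟨m, hm⟩ : ∃ m, m = d.natDegree := ⟨_, rfl⟩
    have hdm : d.degree = m := by rw [degree_eq_natDegree hd0, hm]
    have hmn : m < n := by rw [hdm] at hdlt; exact_mod_cast hdlt
    have hPmd : (P m).degree = m := by
      rw [degree_eq_natDegree (hops.monic m).ne_zero, hops.deg]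
    have z1 : u (d * P m) = 0 := by
      rw [hd, sub_mul, map_sub, horth n m hmn.ne', mul_comm,
        orth19 u (RH19 t n) n (fun k hk => hRo k n hk) (P m)
          (by rw [hPmd]; exact_mod_cast hmn), sub_zero]
    have hlc : d.leadingCoeff ≠ 0 := leadingCoeff_ne_zero.2 hd0
    have z2 : u ((d - Polynomial.C d.leadingCoeff * P m) * P m) = 0 := by
      refine hPo m _ ?_ m le_rfl
      rw [← hdm]
      refine degree_sub_lt_left ?_ hd0 ?_
      · rw [degree_C_mul hlc, hPmd, hdm]
      · rw [leadingCoeff_mul, leadingCoeff_C, (hops.monic m).leadingCoeff, mul_one]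
    rw [sub_mul, map_sub, z1, mul_assoc, ← smul_eq_C_mul, map_smul, ← pow_two, zero_sub,
      neg_eq_zero, smul_eq_mul] at z2
    exact (mul_ne_zero hlc (hreg m)) z2
  have hcmp : ∀ n, B (n + 1) = 0 ∧ Co (n + 1) = cc19 t (n + 1) := by
    intro n
    have h3 := hops.ttrr n
    rw [hPR, hPR, hPR] at h3
    have h4 : Polynomial.C (B (n + 1)) * RH19 t (n + 1) =
        Polynomial.C (cc19 t (n + 1) - Co (n + 1)) * RH19 t n := by
      simp only [RH19] at h3
      rw [C_sub]
      linear_combination h3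
    obtain ⟨m1, d1⟩ := RH19_monic t (n + 1)
    obtain ⟨m0, d0⟩ := RH19_monic t n
    have k1 : (RH19 t (n + 1)).coeff (n + 1) = 1 := by
      have := m1.coeff_natDegree
      rwa [d1] at this
    have k0 : (RH19 t n).coeff n = 1 := by
      have := m0.coeff_natDegree
      rwa [d0] at this
    have hB : B (n + 1) = 0 := by
      have := congrArg (fun p => coeff p (n + 1)) h4
      simp only [coeff_C_mul, k1] at this
      rw [coeff_eq_zero_of_natDegree_lt (p := RH19 t n) (by omega)] at this
      simpa using this
    refine ⟨hB, ?_⟩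
    have := congrArg (fun p => coeff p n) h4
    simp only [coeff_C_mul, k0, hB] at this
    linear_combination this
  refine ⟨?_, ?_, ?_⟩
  · rintro (_ | n)
    · have h3 := hops.p1
      rw [hPR] at h3
      have := congrArg (fun p => coeff p 0) h3
      simpa [RH19] using this
    · exact (hcmp n).1
  · intro n
    rw [(hcmp n).2, cc19, ht, mul_comm 2 s, mul_assoc, zpow_mul]
    norm_cast
  · intro n
    rw [hPR, hPR]
    exact hA n
end
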